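/- Let ζ ∈ ℂ^m with 1 ≤ m < ∞, M a finitely generated O_ζ-module with depth_{m_ζ} M > 0, and p : O_ζ^n → M an O_ζ-epimorphism. Then every O_ζ-module homomorphism φ : O^E_ζ → M, where E is a complex Banach space, factors through p: there is an O_ζ-homomorphism ψ : O^E_ζ → O_ζ^n with φ = pψ. -/

import Mathlib

open Filter Topology

/-- The value at `a` of a germ at `a` (well defined since every neighborhood contains `a`). -/
noncomputable def germValue {α β : Type*} [TopologicalSpace α] (a : α) :
    Filter.Germ (𝓝 a) β → β :=
  fun g => g.liftOn (fun f => f a) (fun _ _ h => h.self_of_nhds)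

variable (X : Type*) [NormedAddCommGroup X] [NormedSpace ℂ X]

/-- The local ring `O_ζ` of scalar holomorphic germs at `ζ`. -/
noncomputable def Oat (ζ : X) : Subring (Filter.Germ (𝓝 ζ) ℂ) where
  carrier := {g | ∃ f : X → ℂ, AnalyticAt ℂ f ζ ∧ g = ↑f}
  mul_mem' := by
    rintro a b ⟨f, hf, rfl⟩ ⟨k, hk, rfl⟩
    exact ⟨f * k, hf.mul hk, rfl⟩
  one_mem' := ⟨fun _ => 1, analyticAt_const, rfl⟩
  add_mem' := by
    rintro a b ⟨f, hf, rfl⟩ ⟨k, hk, rfl⟩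
    exact ⟨f + k, hf.add hk, rfl⟩
  zero_mem' := ⟨fun _ => 0, analyticAt_const, rfl⟩
  neg_mem' := by
    rintro a ⟨f, hf, rfl⟩
    exact ⟨-f, hf.neg, rfl⟩

noncomputable instance (ζ : X) (M : Type*) [AddCommGroup M]
    [Module (Filter.Germ (𝓝 ζ) ℂ) M] : Module (Oat X ζ) M :=
  Module.compHom M (Oat X ζ).subtype

variable (E : Type*) [NormedAddCommGroup E] [NormedSpace ℂ E]

/-- The `O_ζ`-module `O^E_ζ` of `E`-valued holomorphic germs at `ζ` (a "plain module"). -/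
noncomputable def OEat (ζ : X) : Submodule (Oat X ζ) (Filter.Germ (𝓝 ζ) E) where
  carrier := {g | ∃ f : X → E, AnalyticAt ℂ f ζ ∧ g = ↑f}
  add_mem' := by
    rintro a b ⟨f, hf, rfl⟩ ⟨k, hk, rfl⟩
    exact ⟨f + k, hf.add hk, rfl⟩
  zero_mem' := ⟨fun _ => 0, analyticAt_const, rfl⟩
  smul_mem' := by
    rintro ⟨c, a, ha, rfl⟩ x ⟨f, hf, rfl⟩
    exact ⟨fun z => a z • f z, ha.smul hf, rfl⟩

/-- The germ at `ζ` of a function analytic at `ζ`, as an element of `O^E_ζ`. -/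
noncomputable def germOf (ζ : X) (f : X → E) (hf : AnalyticAt ℂ f ζ) : OEat X E ζ :=
  ⟨(↑f : Filter.Germ (𝓝 ζ) E), f, hf, rfl⟩

/-- The constant germ at `ζ` with value `v`. -/
noncomputable def constGerm (ζ : X) (v : E) : OEat X E ζ :=
  germOf X E ζ (fun _ => v) analyticAt_const

/-- Evaluation at `ζ` as a ring homomorphism `O_ζ → ℂ`. -/
noncomputable def evalAt (ζ : X) : Oat X ζ →+* ℂ where
  toFun g := germValue ζ (g : Filter.Germ (𝓝 ζ) ℂ)
  map_one' := rfl
  map_mul' := by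
    rintro ⟨a, _⟩ ⟨b, _⟩
    induction a using Filter.Germ.inductionOn
    induction b using Filter.Germ.inductionOn
    rfl
  map_zero' := rfl
  map_add' := by
    rintro ⟨a, _⟩ ⟨b, _⟩
    induction a using Filter.Germ.inductionOn
    induction b using Filter.Germ.inductionOn
    rfl

/-- The maximal ideal `m_ζ ⊂ O_ζ` of germs vanishing at `ζ`. -/
noncomputable def mIdeal (ζ : X) : Ideal (Oat X ζ) := RingHom.ker (evalAt X ζ)

/-- Positivity of the `I`-depth of a module `M`: either `M = IM` (depth `+∞` by convention),
or there is a nonzerodivisor `r ∈ I` on `M` with `rM ≠ M`. -/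
def IsDepthPos (R : Type*) [CommRing R] (I : Ideal R) (M : Type*) [AddCommGroup M]
    [Module R M] : Prop :=
  (I • (⊤ : Submodule R M) = ⊤) ∨
    ∃ r ∈ I, (∀ x : M, r • x = 0 → x = 0) ∧ Ideal.span {r} • (⊤ : Submodule R M) ≠ ⊤

open scoped NNReal ENNReal

section Expansions

variable {m : ℕ} {V : Type*} [NormedAddCommGroup V]

/-- The monomial `z ^ α`. -/
def monom (z : Fin m → ℂ) (α : Fin m →₀ ℕ) : ℂ := ∏ i, z i ^ α i

/-- The weight `r ^ α` of a multi-index. -/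
noncomputable def weight (r : Fin m → ℝ≥0) (α : Fin m →₀ ℕ) : ℝ≥0∞ := ∏ i, (r i : ℝ≥0∞) ^ α i

/-- The weighted `ℓ¹` norm of a family of Taylor coefficients. -/
noncomputable def weightedNorm (r : Fin m → ℝ≥0) (a : (Fin m →₀ ℕ) → V) : ℝ≥0∞ :=
  ∑' α, ‖a α‖ₑ * weight r α

/-- The family `a` has finite weighted norm for some positive radii. -/
def IsConvergent (a : (Fin m →₀ ℕ) → V) : Prop :=
  ∃ r : Fin m → ℝ≥0, (∀ i, 0 < r i) ∧ weightedNorm r a ≠ ⊤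

lemma monom_add (z : Fin m → ℂ) (α β : Fin m →₀ ℕ) :
    monom z (α + β) = monom z α * monom z β := by
  simp [monom, pow_add, Finset.prod_mul_distrib]

lemma monom_zero (z : Fin m → ℂ) : monom z 0 = 1 := by simp [monom]

lemma monom_single (z : Fin m → ℂ) (i : Fin m) (d : ℕ) :
    monom z (Finsupp.single i d) = z i ^ d := by
  rw [monom, Finset.prod_eq_single i]
  · simp
  · intro j _ hj
    simp [Finsupp.single_eq_of_ne hj]
  · simp

lemma weight_add (r : Fin m → ℝ≥0) (α β : Fin m →₀ ℕ) :
    weight r (α + β) = weight r α * weight r β := by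
  simp [weight, pow_add, Finset.prod_mul_distrib]

lemma weight_mono {r s : Fin m → ℝ≥0} (h : r ≤ s) (α : Fin m →₀ ℕ) :
    weight r α ≤ weight s α := by
  unfold weight
  gcongr with i
  exact h i

lemma weight_const (r : ℝ≥0) (α : Fin m →₀ ℕ) :
    weight (fun _ => r) α = (r : ℝ≥0∞) ^ α.degree := by
  simp [weight, Finset.prod_pow_eq_pow_sum, Finsupp.degree_eq_sum]

lemma enorm_monom (z : Fin m → ℂ) (α : Fin m →₀ ℕ) :
    ‖monom z α‖ₑ = weight (fun i => ‖z i‖₊) α := by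
  simp only [monom, weight, enorm_eq_nnnorm, nnnorm_prod, nnnorm_pow]
  push_cast
  rfl

lemma weightedNorm_mono {r s : Fin m → ℝ≥0} (h : r ≤ s) (a : (Fin m →₀ ℕ) → V) :
    weightedNorm r a ≤ weightedNorm s a :=
  ENNReal.tsum_le_tsum fun α => by gcongr; exact weight_mono h α

lemma exists_le_radii (r : Fin m → ℝ≥0) (hr : ∀ i, 0 < r i) :
    ∃ s : ℝ≥0, 0 < s ∧ (fun _ => s) ≤ r := by
  rcases isEmpty_or_nonempty (Fin m) with h | h
  · exact ⟨1, one_pos, fun i => h.elim i⟩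
  · refine ⟨Finset.univ.inf' Finset.univ_nonempty r, ?_, fun i => Finset.inf'_le _ (by simp)⟩
    simp [Finset.lt_inf'_iff, hr]

lemma IsConvergent.exists_const {a : (Fin m →₀ ℕ) → V} (ha : IsConvergent a) :
    ∃ s : ℝ≥0, 0 < s ∧ weightedNorm (fun _ => s) a ≠ ⊤ := by
  obtain ⟨r, hr, h⟩ := ha
  obtain ⟨s, hs, hsr⟩ := exists_le_radii r hr
  exact ⟨s, hs, ne_top_of_le_ne_top h (weightedNorm_mono hsr a)⟩

variable [NormedSpace ℂ V]

/-- `f` is the sum near `0` of the convergent power series with coefficients `a`. -/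
def HasExpansion (f : (Fin m → ℂ) → V) (a : (Fin m →₀ ℕ) → V) : Prop :=
  IsConvergent a ∧ ∀ᶠ z in 𝓝 0, HasSum (fun α => monom z α • a α) (f z)

lemma summable_norm_of_weightedNorm {r : Fin m → ℝ≥0} {a : (Fin m →₀ ℕ) → V}
    (h : weightedNorm r a ≠ ⊤) {z : Fin m → ℂ} (hz : ∀ i, ‖z i‖₊ ≤ r i) :
    Summable fun α => ‖monom z α • a α‖ := by
  have : ∑' α, ‖monom z α • a α‖ₑ ≠ ⊤ := by
    refine ne_top_of_le_ne_top h (ENNReal.tsum_le_tsum fun α => ?_)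
    rw [enorm_smul, enorm_monom, mul_comm]
    gcongr
    exact weight_mono hz α
  have h2 : Summable fun α => ‖monom z α • a α‖₊ :=
    ENNReal.tsum_coe_ne_top_iff_summable.1 (by simpa only [enorm_eq_nnnorm] using this)
  exact NNReal.summable_coe.2 h2

lemma eventually_nnnorm_le {r : Fin m → ℝ≥0} (hr : ∀ i, 0 < r i) :
    ∀ᶠ z : Fin m → ℂ in 𝓝 0, ∀ i, ‖z i‖₊ ≤ r i := by
  rw [eventually_all]
  intro i
  have : Tendsto (fun z : Fin m → ℂ => ‖z i‖₊) (𝓝 0) (𝓝 0) := by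
    have : Continuous (fun z : Fin m → ℂ => ‖z i‖₊) := by fun_prop
    simpa using this.tendsto 0
  exact (this.eventually (gt_mem_nhds (hr i))).mono fun z hz => hz.le

lemma IsConvergent.eventually_summable {a : (Fin m →₀ ℕ) → V} (ha : IsConvergent a) :
    ∀ᶠ z in 𝓝 0, Summable fun α => ‖monom z α • a α‖ := by
  obtain ⟨r, hr, h⟩ := ha
  filter_upwards [eventually_nnnorm_le hr] with z hz
  exact summable_norm_of_weightedNorm h hz

/-- The multi-index counting the letters of a word. -/
noncomputable def wordIndex {n : ℕ} (w : Fin n → Fin m) : Fin m →₀ ℕ := ∑ k, Finsupp.single (w k) 1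

lemma degree_wordIndex {n : ℕ} (w : Fin n → Fin m) : (wordIndex w).degree = n := by
  simp [wordIndex, map_sum]

lemma prod_word {n : ℕ} (w : Fin n → Fin m) (z : Fin m → ℂ) :
    ∏ k, z (w k) = monom z (wordIndex w) := by
  have (s : Finset (Fin n)) :
      ∏ k ∈ s, z (w k) = monom z (∑ k ∈ s, Finsupp.single (w k) 1) := by
    classical
    induction s using Finset.induction_on with
    | empty => simp [monom_zero]
    | insert a s ha ih => rw [Finset.prod_insert ha, Finset.sum_insert ha, monom_add, ih,
        monom_single, pow_one]
  exact this _

lemma exists_word (α : Fin m →₀ ℕ) {n : ℕ} (hn : α.degree = n) :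
    ∃ w : Fin n → Fin m, wordIndex w = α := by
  induction n generalizing α with
  | zero =>
    have : α = 0 := (Finsupp.degree_eq_zero_iff α).1 hn
    exact ⟨Fin.elim0, by simp [wordIndex, this]⟩
  | succ n ih =>
    have hα : α ≠ 0 := by rintro rfl; simp at hn
    obtain ⟨i, hi⟩ := Finsupp.ne_iff.1 hα
    have hle : Finsupp.single i 1 ≤ α := by
      rw [Finsupp.single_le_iff]; exact Nat.one_le_iff_ne_zero.2 hi
    obtain ⟨β, rfl⟩ := exists_add_of_le hle
    have hβ : β.degree = n := by
      have h2 : (Finsupp.single i 1).degree + β.degree = n + 1 := by rw [← map_add]; exact hn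
      simp at h2; omega
    obtain ⟨w, hw⟩ := ih β hβ
    exact ⟨Fin.cons i w, by simp [wordIndex, Fin.sum_univ_succ, ← hw]⟩

lemma mem_finsuppAntidiag_univ {n : ℕ} {α : Fin m →₀ ℕ} :
    α ∈ Finset.finsuppAntidiag Finset.univ n ↔ α.degree = n := by
  simp [Finsupp.degree_eq_sum]

/-- A homogeneous scalar monomial as a multilinear map. -/
noncomputable def wordForm {n : ℕ} (w : Fin n → Fin m) :
    ContinuousMultilinearMap ℂ (fun _ : Fin n => Fin m → ℂ) ℂ :=
  (ContinuousMultilinearMap.mkPiAlgebra ℂ (Fin n) ℂ).compContinuousLinearMap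
    fun k => ContinuousLinearMap.proj (w k)

lemma norm_wordForm_le {n : ℕ} (w : Fin n → Fin m) : ‖wordForm w‖ ≤ 1 := by
  refine ContinuousMultilinearMap.opNorm_le_bound zero_le_one fun z => ?_
  simp only [wordForm, ContinuousMultilinearMap.compContinuousLinearMap_apply,
    ContinuousLinearMap.proj_apply, ContinuousMultilinearMap.mkPiAlgebra_apply, norm_prod, one_mul]
  gcongr with k
  exact norm_le_pi_norm _ _

/-- The formal multilinear series with given Taylor coefficients. -/
noncomputable def seriesOfCoeff (a : (Fin m →₀ ℕ) → V) :
    FormalMultilinearSeries ℂ (Fin m → ℂ) V := fun n =>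
  ∑ α : {α : Fin m →₀ ℕ // α ∈ Finset.finsuppAntidiag Finset.univ n},
    (wordForm (exists_word α.1 (n := n)
      (mem_finsuppAntidiag_univ.1 α.2)).choose).smulRight (a α)

lemma seriesOfCoeff_apply (a : (Fin m →₀ ℕ) → V) (n : ℕ) (z : Fin m → ℂ) :
    seriesOfCoeff a n (fun _ => z) =
      ∑ α ∈ Finset.finsuppAntidiag Finset.univ n, monom z α • a α := by
  rw [← Finset.sum_coe_sort]
  simp only [seriesOfCoeff, sum_apply]
  refine Finset.sum_congr rfl fun α _ => ?_
  have := (exists_word α.1 (n := n) (mem_finsuppAntidiag_univ.1 α.2)).choose_spec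
  conv_rhs => rw [← this, ← prod_word]
  simp [wordForm, this]

lemma hasFPowerSeriesAt_of_isConvergent [CompleteSpace V] {a : (Fin m →₀ ℕ) → V}
    (ha : IsConvergent a) :
    HasFPowerSeriesAt (fun z => ∑' α, monom z α • a α) (seriesOfCoeff a) 0 := by
  obtain ⟨s, hs, h⟩ := ha.exists_const
  have hsum : Summable fun α => ‖a α‖ * (s : ℝ) ^ α.degree := by
    have h2 : Summable fun α => ‖a α‖₊ * s ^ α.degree :=
      ENNReal.tsum_coe_ne_top_iff_summable.1 (by
        push_cast
        simpa only [weightedNorm, weight_const, enorm_eq_nnnorm] using h)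
    exact (NNReal.summable_coe.2 h2).congr fun α => by simp
  have hrad : (s : ℝ≥0∞) ≤ (seriesOfCoeff a).radius := by
    refine (seriesOfCoeff a).le_radius_of_bound (∑' α, ‖a α‖ * (s : ℝ) ^ α.degree) fun n => ?_
    calc ‖seriesOfCoeff a n‖ * (s : ℝ) ^ n
        ≤ (∑ α : {α : Fin m →₀ ℕ // α ∈ Finset.finsuppAntidiag Finset.univ n}, ‖a α‖)
          * (s : ℝ) ^ n := by
          gcongr
          refine (norm_sum_le _ _).trans (Finset.sum_le_sum fun α _ => ?_)
          rw [ContinuousMultilinearMap.norm_smulRight]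
          exact mul_le_of_le_one_left (norm_nonneg _) (norm_wordForm_le _)
      _ = ∑ α ∈ Finset.finsuppAntidiag Finset.univ n, ‖a α‖ * (s : ℝ) ^ α.degree := by
          rw [Finset.sum_coe_sort _ (fun α => ‖a α‖), Finset.sum_mul]
          refine Finset.sum_congr rfl fun α hα => ?_
          rw [mem_finsuppAntidiag_univ.1 hα]
      _ ≤ _ := hsum.sum_le_tsum _ fun α _ => by positivity
  have hpos : 0 < (seriesOfCoeff a).radius :=
    lt_of_lt_of_le (by exact_mod_cast hs) hrad
  have key := ((seriesOfCoeff a).hasFPowerSeriesOnBall hpos).hasFPowerSeriesAt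
  refine key.congr ?_
  filter_upwards [ha.eventually_summable] with z hz
  have h1 : HasSum (fun α => monom z α • a α) (∑' α, monom z α • a α) := hz.of_norm.hasSum
  rw [← (Equiv.sigmaFiberEquiv (Finsupp.degree (R := ℕ) (σ := Fin m))).hasSum_iff] at h1
  have h2 := h1.sigma (g := fun n => seriesOfCoeff a n (fun _ => z)) fun n => by
    rw [seriesOfCoeff_apply]
    rw [← (Equiv.subtypeEquivRight fun α => mem_finsuppAntidiag_univ (m := m) (n := n)
      (α := α)).hasSum_iff]
    exact Finset.hasSum _ (fun α => monom z α • a α)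
  exact h2.tsum_eq

lemma HasExpansion.analyticAt [CompleteSpace V] {f : (Fin m → ℂ) → V} {a : (Fin m →₀ ℕ) → V}
    (h : HasExpansion f a) : AnalyticAt ℂ f 0 := by
  refine (hasFPowerSeriesAt_of_isConvergent h.1).analyticAt.congr ?_
  filter_upwards [h.2] with z hz using hz.tsum_eq

lemma IsConvergent.hasExpansion [CompleteSpace V] {a : (Fin m →₀ ℕ) → V}
    (h : IsConvergent a) : HasExpansion (fun z => ∑' α, monom z α • a α) a :=
  ⟨h, by filter_upwards [h.eventually_summable] with z hz using hz.of_norm.hasSum⟩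

lemma HasExpansion.congr {f g : (Fin m → ℂ) → V} {a : (Fin m →₀ ℕ) → V}
    (h : HasExpansion f a) (hfg : f =ᶠ[𝓝 0] g) : HasExpansion g a :=
  ⟨h.1, by filter_upwards [h.2, hfg] with z hz hz2 using hz2 ▸ hz⟩

lemma HasExpansion.eq_zero {a : (Fin m →₀ ℕ) → ℂ}
    (h : HasExpansion (fun _ => 0) a) : a = 0 := by
  have h0 : HasFPowerSeriesAt 0 (seriesOfCoeff a) 0 := by
    refine (hasFPowerSeriesAt_of_isConvergent h.1).congr ?_
    filter_upwards [h.2] with z hz using hz.tsum_eq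
  ext β
  set n := β.degree with hn
  have hp : (∑ α ∈ Finset.finsuppAntidiag Finset.univ n, MvPolynomial.monomial α (a α)) = 0 := by
    refine MvPolynomial.funext fun z => ?_
    have := h0.apply_eq_zero n z
    rw [seriesOfCoeff_apply] at this
    rw [map_sum, map_zero, ← this]
    refine Finset.sum_congr rfl fun α _ => ?_
    simp [MvPolynomial.eval_monomial, monom, Finsupp.prod_fintype, mul_comm]
  have := congrArg (MvPolynomial.coeff β) hp
  rw [MvPolynomial.coeff_sum, Finset.sum_eq_single β] at this
  · simpa using this
  · intro α _ hα
    simp [MvPolynomial.coeff_monomial, hα]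
  · intro hβ
    exact absurd (mem_finsuppAntidiag_univ.2 hn.symm) hβ

end Expansions

section Expansions

variable {m : ℕ} {V : Type*} [NormedAddCommGroup V] [NormedSpace ℂ V]

lemma apply_eq_sum_words {n : ℕ} (q : ContinuousMultilinearMap ℂ (fun _ : Fin n => Fin m → ℂ) V)
    (z : Fin m → ℂ) :
    q (fun _ => z) =
      ∑ w : Fin n → Fin m, monom z (wordIndex w) • q (fun k => Pi.single (w k) 1) := by
  have hz : z = ∑ i, z i • (Pi.single i 1 : Fin m → ℂ) := by
    ext j
    simp [Finset.sum_apply, Pi.single_apply]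
  conv_lhs => rw [hz]
  rw [ContinuousMultilinearMap.map_sum]
  refine Finset.sum_congr rfl fun w _ => ?_
  rw [← prod_word]
  exact q.map_smul_univ _ _

theorem AnalyticAt.exists_hasExpansion [CompleteSpace V] {f : (Fin m → ℂ) → V}
    (hf : AnalyticAt ℂ f 0) : ∃ a, HasExpansion f a := by
  obtain ⟨p, R, hp⟩ := hf
  let u : (Σ n, (Fin n → Fin m)) → V := fun x => p x.1 fun k => Pi.single (x.2 k) 1
  have hu (x) : ‖u x‖₊ ≤ ‖p x.1‖₊ := by
    refine ((p x.1).le_opNNNorm _).trans ?_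
    refine mul_le_of_le_one_right (by positivity) (Finset.prod_le_one (by simp) fun k _ => ?_)
    rw [← NNReal.coe_le_coe, coe_nnnorm, Pi.norm_single]
    simp
  obtain ⟨t, ht0, ht⟩ := ENNReal.lt_iff_exists_nnreal_btwn.1 hp.radius_pos
  have ht0' : 0 < t := by exact_mod_cast ht0
  let s : ℝ≥0 := t / (m + 1)
  have hs : 0 < s := by positivity
  have hms : m * s ≤ t := by
    simp only [s]
    rw [mul_div_assoc', div_le_iff₀ (by positivity), mul_comm]
    gcongr
    simp
  have hfin : ∑' x, ‖u x‖ₑ * (s : ℝ≥0∞) ^ x.1 ≠ ⊤ := by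
    have h1 := ENNReal.tsum_coe_ne_top_iff_summable.2 (p.summable_nnnorm_mul_pow ht)
    refine ne_top_of_le_ne_top h1 ?_
    rw [ENNReal.tsum_sigma']
    refine ENNReal.tsum_le_tsum fun n => ?_
    calc ∑' w : Fin n → Fin m, ‖u ⟨n, w⟩‖ₑ * (s : ℝ≥0∞) ^ n
        ≤ ∑' w : Fin n → Fin m, (‖p n‖₊ : ℝ≥0∞) * (s : ℝ≥0∞) ^ n :=
          ENNReal.tsum_le_tsum fun w => by
            gcongr
            exact_mod_cast hu ⟨n, w⟩
      _ = ((‖p n‖₊ * (m * s) ^ n : ℝ≥0) : ℝ≥0∞) := by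
          rw [tsum_fintype]
          simp [mul_pow]
          ring
      _ ≤ _ := by gcongr
  let a : (Fin m →₀ ℕ) → V := fun α =>
    ∑' x : {x : Σ n, (Fin n → Fin m) // wordIndex x.2 = α}, u x
  have hfib (α) : Summable fun x : {x : Σ n, (Fin n → Fin m) // wordIndex x.2 = α} => u x := by
    have h2 : ∑' x : {x : Σ n, (Fin n → Fin m) // wordIndex x.2 = α},
        ‖u x‖ₑ * (s : ℝ≥0∞) ^ α.degree ≠ ⊤ := by
      refine ne_top_of_le_ne_top hfin (le_trans (le_of_eq ?_)
        (ENNReal.tsum_comp_le_tsum_of_injective (Subtype.val_injective (p := fun x =>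
          wordIndex x.2 = α)) fun x => ‖u x‖ₑ * (s : ℝ≥0∞) ^ x.1))
      refine tsum_congr fun x => ?_
      rw [← degree_wordIndex x.1.2, x.2]
    rw [ENNReal.tsum_mul_right] at h2
    have h3 : ∑' x : {x : Σ n, (Fin n → Fin m) // wordIndex x.2 = α}, ‖u x‖ₑ ≠ ⊤ := by
      intro h
      refine h2 ?_
      rw [h, ENNReal.top_mul]
      exact pow_ne_zero _ (by exact_mod_cast hs.ne')
    have h4 : Summable fun x : {x : Σ n, (Fin n → Fin m) // wordIndex x.2 = α} => ‖u x‖₊ :=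
      ENNReal.tsum_coe_ne_top_iff_summable.1 (by simpa only [enorm_eq_nnnorm] using h3)
    exact .of_norm (NNReal.summable_coe.2 h4)
  have ha : weightedNorm (fun _ => s) a ≠ ⊤ := by
    refine ne_top_of_le_ne_top hfin ?_
    rw [← (Equiv.sigmaFiberEquiv fun x : Σ n, (Fin n → Fin m) => wordIndex x.2).tsum_eq,
      ENNReal.tsum_sigma']
    refine ENNReal.tsum_le_tsum fun α => ?_
    have : ‖a α‖ₑ ≤ ∑' x : {x : Σ n, (Fin n → Fin m) // wordIndex x.2 = α}, ‖u x‖ₑ :=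
      enorm_tsum_le_tsum_enorm
    rw [weight_const]
    refine (mul_le_mul_left this _).trans (le_of_eq ?_)
    rw [← ENNReal.tsum_mul_right]
    refine tsum_congr fun x => ?_
    simp only [Equiv.sigmaFiberEquiv, Equiv.coe_fn_mk]
    have hx : α.degree = x.1.1 := by
      obtain ⟨x, rfl⟩ := x
      exact degree_wordIndex x.2
    rw [hx]
  refine ⟨a, ⟨fun _ => s, fun _ => hs, ha⟩, ?_⟩
  filter_upwards [eventually_nnnorm_le (fun _ : Fin m => hs),
    Metric.eball_mem_nhds 0 hp.r_pos] with z hz hzR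
  have hS : Summable fun x : Σ n, (Fin n → Fin m) => monom z (wordIndex x.2) • u x := by
    have h4 : Summable fun x : Σ n, (Fin n → Fin m) => ‖monom z (wordIndex x.2) • u x‖₊ := by
      refine ENNReal.tsum_coe_ne_top_iff_summable.1 (ne_top_of_le_ne_top hfin
        (ENNReal.tsum_le_tsum fun x => ?_))
      rw [← enorm_eq_nnnorm, enorm_smul, enorm_monom, mul_comm]
      gcongr
      refine (weight_mono (s := fun _ => s) hz _).trans ?_
      rw [weight_const, degree_wordIndex]
    exact .of_norm (NNReal.summable_coe.2 h4)
  have h1 : HasSum (fun x : Σ n, (Fin n → Fin m) => monom z (wordIndex x.2) • u x) (f z) := by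
    have h5 := hS.hasSum
    have h6 := h5.sigma (g := fun n => p n fun _ => z) fun n => by
      rw [apply_eq_sum_words]
      exact hasSum_fintype _
    have h7 := hp.hasSum hzR
    rw [zero_add] at h7
    rwa [h6.unique h7] at h5
  rw [← (Equiv.sigmaFiberEquiv fun x : Σ n, (Fin n → Fin m) => wordIndex x.2).hasSum_iff] at h1
  refine h1.sigma fun α => ?_
  convert (hfib α).hasSum.const_smul (monom z α) using 2 with x
  simp [Equiv.sigmaFiberEquiv, x.2]

lemma HasExpansion.add {f g : (Fin m → ℂ) → V} {a b : (Fin m →₀ ℕ) → V}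
    (hf : HasExpansion f a) (hg : HasExpansion g b) :
    HasExpansion (fun z => f z + g z) (fun α => a α + b α) := by
  refine ⟨?_, ?_⟩
  · obtain ⟨⟨r, hr, h1⟩, -⟩ := hf
    obtain ⟨⟨s, hs, h2⟩, -⟩ := hg
    refine ⟨r ⊓ s, fun i => lt_min (hr i) (hs i), ?_⟩
    refine ne_top_of_le_ne_top (ENNReal.add_ne_top.2 ⟨h1, h2⟩) ?_
    rw [weightedNorm, weightedNorm, weightedNorm, ← ENNReal.tsum_add]
    refine ENNReal.tsum_le_tsum fun α => ?_
    calc ‖a α + b α‖ₑ * weight (r ⊓ s) α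
        ≤ (‖a α‖ₑ + ‖b α‖ₑ) * weight (r ⊓ s) α := by gcongr; exact enorm_add_le _ _
      _ = ‖a α‖ₑ * weight (r ⊓ s) α + ‖b α‖ₑ * weight (r ⊓ s) α := add_mul _ _ _
      _ ≤ _ := by gcongr <;> exact weight_mono (by simp) α
  · filter_upwards [hf.2, hg.2] with z h1 h2
    simpa only [smul_add] using h1.add h2

lemma HasExpansion.clm_comp {W : Type*} [NormedAddCommGroup W] [NormedSpace ℂ W]
    {f : (Fin m → ℂ) → V} {a : (Fin m →₀ ℕ) → V} (hf : HasExpansion f a) (T : V →L[ℂ] W) :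
    HasExpansion (fun z => T (f z)) (fun α => T (a α)) := by
  refine ⟨?_, ?_⟩
  · obtain ⟨⟨r, hr, h1⟩, -⟩ := hf
    refine ⟨r, hr, ne_top_of_le_ne_top (ENNReal.mul_ne_top (enorm_ne_top (x := T)) h1) ?_⟩
    rw [weightedNorm, weightedNorm, ← ENNReal.tsum_mul_left]
    refine ENNReal.tsum_le_tsum fun α => ?_
    rw [← mul_assoc]
    gcongr
    exact T.le_opENorm _
  · filter_upwards [hf.2] with z h1
    simpa only [map_smul] using h1.mapL T

/-- The coefficients of the product with the monomial of exponent `β`. -/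
noncomputable def shiftUp (β : Fin m →₀ ℕ) (a : (Fin m →₀ ℕ) → V) (α : Fin m →₀ ℕ) : V :=
  open Classical in if β ≤ α then a (α - β) else 0

@[simp]
lemma shiftUp_add (β : Fin m →₀ ℕ) (a : (Fin m →₀ ℕ) → V) (α : Fin m →₀ ℕ) :
    shiftUp β a (α + β) = a α := by
  simp [shiftUp]

lemma shiftUp_of_notMem_range {β : Fin m →₀ ℕ} (a : (Fin m →₀ ℕ) → V) {α : Fin m →₀ ℕ}
    (h : α ∉ Set.range (· + β)) : shiftUp β a α = 0 := by
  rw [shiftUp, if_neg]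
  intro hle
  exact h ⟨α - β, tsub_add_cancel_of_le hle⟩

lemma weightedNorm_shiftUp (r : Fin m → ℝ≥0) (β : Fin m →₀ ℕ) (a : (Fin m →₀ ℕ) → V) :
    weightedNorm r (shiftUp β a) = weight r β * weightedNorm r a := by
  rw [weightedNorm, weightedNorm, ← ENNReal.tsum_mul_left,
    ← (add_left_injective β).tsum_eq (f := fun α => ‖shiftUp β a α‖ₑ * weight r α)]
  · refine tsum_congr fun α => ?_
    simp only [shiftUp_add, weight_add]
    ring
  · intro α hα
    by_contra h
    exact hα (by simp [shiftUp_of_notMem_range a h])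

lemma weight_ne_top (r : Fin m → ℝ≥0) (α : Fin m →₀ ℕ) : weight r α ≠ ⊤ :=
  ENNReal.prod_ne_top fun _ _ => ENNReal.pow_ne_top ENNReal.coe_ne_top

lemma HasExpansion.monom_smul {f : (Fin m → ℂ) → V} {a : (Fin m →₀ ℕ) → V}
    (hf : HasExpansion f a) (β : Fin m →₀ ℕ) :
    HasExpansion (fun z => monom z β • f z) (shiftUp β a) := by
  refine ⟨?_, ?_⟩
  · obtain ⟨⟨r, hr, h1⟩, -⟩ := hf
    refine ⟨r, hr, ?_⟩
    rw [weightedNorm_shiftUp]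
    exact ENNReal.mul_ne_top (weight_ne_top r β) h1
  · filter_upwards [hf.2] with z h1
    rw [← (add_left_injective β).hasSum_iff]
    · convert h1.const_smul (monom z β) using 2 with α
      simp [monom_add, smul_smul, mul_comm]
    · intro α hα
      rw [shiftUp_of_notMem_range a hα, smul_zero]

/-- The Cauchy product of scalar and vector coefficients. -/
noncomputable def cauchyProd (c : (Fin m →₀ ℕ) → ℂ) (a : (Fin m →₀ ℕ) → V)
    (α : Fin m →₀ ℕ) : V :=
  ∑ x ∈ Finset.HasAntidiagonal.antidiagonal α, c x.1 • a x.2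

lemma weightedNorm_cauchyProd_le (r : Fin m → ℝ≥0) (c : (Fin m →₀ ℕ) → ℂ)
    (a : (Fin m →₀ ℕ) → V) :
    weightedNorm r (cauchyProd c a) ≤ weightedNorm r c * weightedNorm r a := by
  calc weightedNorm r (cauchyProd c a)
      ≤ ∑' α, ∑ x ∈ Finset.HasAntidiagonal.antidiagonal α,
          (‖c x.1‖ₑ * weight r x.1) * (‖a x.2‖ₑ * weight r x.2) := by
        refine ENNReal.tsum_le_tsum fun α => ?_
        refine (mul_le_mul_left (enorm_sum_le _ _) _).trans ?_
        rw [Finset.sum_mul]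
        refine Finset.sum_le_sum fun x hx => ?_
        rw [← Finset.HasAntidiagonal.mem_antidiagonal.1 hx, weight_add, enorm_smul]
        exact le_of_eq (by ring)
    _ = ∑' x : Σ α : Fin m →₀ ℕ, Finset.HasAntidiagonal.antidiagonal α,
          (‖c x.2.1.1‖ₑ * weight r x.2.1.1) * (‖a x.2.1.2‖ₑ * weight r x.2.1.2) := by
        rw [ENNReal.tsum_sigma']
        refine tsum_congr fun α => ?_
        rw [tsum_fintype, Finset.sum_coe_sort (Finset.HasAntidiagonal.antidiagonal α)
          (fun x => (‖c x.1‖ₑ * weight r x.1) * (‖a x.2‖ₑ * weight r x.2))]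
    _ = ∑' x : (Fin m →₀ ℕ) × (Fin m →₀ ℕ),
          (‖c x.1‖ₑ * weight r x.1) * (‖a x.2‖ₑ * weight r x.2) :=
        Finset.HasAntidiagonal.sigmaAntidiagonalEquivProd.tsum_eq
          (fun x : (Fin m →₀ ℕ) × (Fin m →₀ ℕ) =>
            (‖c x.1‖ₑ * weight r x.1) * (‖a x.2‖ₑ * weight r x.2))
    _ = _ := by
        rw [ENNReal.tsum_prod']
        simp only [ENNReal.tsum_mul_left, ENNReal.tsum_mul_right]
        rfl

lemma HasExpansion.smul [CompleteSpace V] {h : (Fin m → ℂ) → ℂ} {c : (Fin m →₀ ℕ) → ℂ}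
    {f : (Fin m → ℂ) → V} {a : (Fin m →₀ ℕ) → V}
    (hh : HasExpansion h c) (hf : HasExpansion f a) :
    HasExpansion (fun z => h z • f z) (cauchyProd c a) := by
  refine ⟨?_, ?_⟩
  · obtain ⟨⟨r, hr, h1⟩, -⟩ := hh
    obtain ⟨⟨s, hs, h2⟩, -⟩ := hf
    refine ⟨r ⊓ s, fun i => lt_min (hr i) (hs i), ne_top_of_le_ne_top
      (ENNReal.mul_ne_top h1 h2) ((weightedNorm_cauchyProd_le _ _ _).trans ?_)⟩
    gcongr <;> exact weightedNorm_mono (by simp) _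
  · filter_upwards [hh.2, hf.2, hh.1.eventually_summable, hf.1.eventually_summable]
      with z h1 h2 h3 h4
    have h5 : Summable fun x : (Fin m →₀ ℕ) × (Fin m →₀ ℕ) =>
        (monom z x.1 • c x.1) • (monom z x.2 • a x.2) := by
      have h6 := h3.mul_of_nonneg h4 (fun _ => norm_nonneg _) (fun _ => norm_nonneg _)
      exact Summable.of_norm (h6.congr fun x => (norm_smul _ _).symm)
    have h7 : HasSum (fun x : (Fin m →₀ ℕ) × (Fin m →₀ ℕ) =>
        (monom z x.1 • c x.1) • (monom z x.2 • a x.2)) (h z • f z) := by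
      have h9 := h5.hasSum.prod_fiberwise fun α => h2.const_smul (monom z α • c α)
      exact (h9.unique (h1.smul_const (f z))) ▸ h5.hasSum
    rw [← Finset.HasAntidiagonal.sigmaAntidiagonalEquivProd.hasSum_iff] at h7
    refine h7.sigma fun α => ?_
    have h8 : monom z α • cauchyProd c a α = ∑ x : Finset.HasAntidiagonal.antidiagonal α,
        (monom z x.1.1 • c x.1.1) • (monom z x.1.2 • a x.1.2) := by
      rw [cauchyProd, Finset.smul_sum, ← Finset.sum_coe_sort]
      refine Finset.sum_congr rfl fun x _ => ?_
      have h10 : monom z α = monom z x.1.1 * monom z x.1.2 := by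
        rw [← monom_add, Finset.HasAntidiagonal.mem_antidiagonal.1 x.2]
      rw [h10]
      simp only [smul_smul, smul_eq_mul]
      congr 1
      ring
    rw [h8]
    exact hasSum_fintype fun x : Finset.HasAntidiagonal.antidiagonal α =>
        (monom z x.1.1 • c x.1.1) • (monom z x.1.2 • a x.1.2)

end Expansions

section Weierstrass

variable {m : ℕ} {V : Type*} [NormedAddCommGroup V]

/-- The coefficients of the quotient upon division by `z 0 ^ d`. -/
noncomputable def shiftDown (d : ℕ) (a : (Fin (m + 1) →₀ ℕ) → V) (α : Fin (m + 1) →₀ ℕ) : V :=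
  a (α + Finsupp.single 0 d)

lemma weight_mul_weightedNorm_shiftDown_le (r : Fin (m + 1) → ℝ≥0) (d : ℕ)
    (a : (Fin (m + 1) →₀ ℕ) → V) :
    weight r (Finsupp.single 0 d) * weightedNorm r (shiftDown d a) ≤ weightedNorm r a := by
  rw [weightedNorm, ← ENNReal.tsum_mul_left]
  refine le_trans (le_of_eq (tsum_congr fun α => ?_))
    (ENNReal.tsum_comp_le_tsum_of_injective (add_left_injective (Finsupp.single 0 d))
      (fun α => ‖a α‖ₑ * weight r α))
  simp only [shiftDown, weight_add]
  ring

lemma weight_single (r : Fin m → ℝ≥0) (i : Fin m) (d : ℕ) :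
    weight r (Finsupp.single i d) = (r i : ℝ≥0∞) ^ d := by
  rw [weight, Finset.prod_eq_single i]
  · simp
  · intro j _ hj
    simp [Finsupp.single_eq_of_ne hj]
  · simp

lemma weight_ne_zero {r : Fin m → ℝ≥0} (hr : ∀ i, 0 < r i) (α : Fin m →₀ ℕ) : weight r α ≠ 0 := by
  rw [weight, Finset.prod_ne_zero_iff]
  exact fun i _ => pow_ne_zero _ (by simpa using (hr i).ne')

lemma weight_cons (r : Fin (m + 1) → ℝ≥0) (i : ℕ) (β : Fin m →₀ ℕ) :
    weight r (Finsupp.cons i β) = (r 0 : ℝ≥0∞) ^ i * weight (Fin.tail r) β := by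
  simp [weight, Fin.prod_univ_succ, Fin.tail]

lemma monom_cons (z : Fin (m + 1) → ℂ) (i : ℕ) (β : Fin m →₀ ℕ) :
    monom z (Finsupp.cons i β) = z 0 ^ i * monom (Fin.tail z) β := by
  simp [monom, Fin.prod_univ_succ, Fin.tail]

lemma exists_radii_weightedNorm_le {c : (Fin (m + 1) →₀ ℕ) → V}
    (hc0 : ∀ i, c (Finsupp.single 0 i) = 0) {s : ℝ≥0} (hs : 0 < s)
    (hc : weightedNorm (fun _ => s) c ≠ ⊤) {ε : ℝ≥0∞} (hε : ε ≠ 0) :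
    ∃ r : Fin (m + 1) → ℝ≥0, (∀ i, 0 < r i) ∧ r 0 = s ∧ r ≤ (fun _ => s) ∧
      weightedNorm r c ≤ ε := by
  obtain ⟨t, ht0, ht⟩ : ∃ t : ℝ≥0, 0 < t ∧ (t : ℝ≥0∞) * weightedNorm (fun _ => s) c < ε := by
    obtain ⟨t, ht0, ht⟩ := ENNReal.exists_nnreal_pos_mul_lt hc hε
    exact ⟨t, ht0, ht⟩
  set t' := min t 1 with ht'
  have ht'0 : 0 < t' := lt_min ht0 one_pos
  refine ⟨Fin.cons s fun _ => t' * s, ?_, rfl, ?_, le_trans ?_ ht.le⟩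
  · intro i
    refine Fin.cases ?_ (fun j => ?_) i
    · simpa
    · simpa using ⟨ht'0, hs⟩
  · intro i
    refine Fin.cases ?_ (fun j => ?_) i
    · simp
    · simp only [Fin.cons_succ]
      exact mul_le_of_le_one_left zero_le (min_le_right t 1)
  · rw [weightedNorm, weightedNorm, ← ENNReal.tsum_mul_left]
    refine ENNReal.tsum_le_tsum fun α => ?_
    by_cases h : ∃ i : Fin m, α i.succ ≠ 0
    · obtain ⟨i, hi⟩ := h
      rw [mul_left_comm]
      gcongr
      have h1 : (∏ j : Fin m, ((t' * s : ℝ≥0) : ℝ≥0∞) ^ α j.succ)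
          ≤ t' * ∏ j : Fin m, (s : ℝ≥0∞) ^ α j.succ := by
        push_cast
        simp only [mul_pow, Finset.prod_mul_distrib]
        gcongr
        rw [← Finset.mul_prod_erase _ _ (Finset.mem_univ i)]
        have ht1 : (t' : ℝ≥0∞) ≤ 1 := by exact_mod_cast min_le_right t 1
        calc _ ≤ (t' : ℝ≥0∞) ^ α i.succ * 1 := by
              gcongr
              exact Finset.prod_le_one' fun j _ => pow_le_one' ht1 _
          _ ≤ t' := by
              rw [mul_one]
              exact (pow_le_pow_right_of_le_one' ht1 (Nat.one_le_iff_ne_zero.2 hi)).trans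
                (pow_one _).le
      rw [weight, weight, Fin.prod_univ_succ, Fin.prod_univ_succ]
      simp only [Fin.cons_zero, Fin.cons_succ]
      calc _ ≤ (s : ℝ≥0∞) ^ α 0 * (t' * ∏ j : Fin m, (s : ℝ≥0∞) ^ α j.succ) := by gcongr
        _ = t' * ((s : ℝ≥0∞) ^ α 0 * ∏ j : Fin m, (s : ℝ≥0∞) ^ α j.succ) := by ring
        _ ≤ _ := by
          gcongr
          exact min_le_left _ _
    · push Not at h
      have : α = Finsupp.single 0 (α 0) := by
        ext i
        refine Fin.cases ?_ (fun j => ?_) i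
        · simp
        · rw [h j, Finsupp.single_eq_of_ne (Fin.succ_ne_zero j)]
      rw [this, hc0]
      simp

variable [NormedSpace ℂ V]

lemma exists_add_shiftDown_cauchyProd_eq [CompleteSpace V] {c : (Fin (m + 1) →₀ ℕ) → ℂ} {d : ℕ}
    {r : Fin (m + 1) → ℝ≥0} (hr : ∀ i, 0 < r i)
    (hc : weightedNorm r c ≤ 2⁻¹ * weight r (Finsupp.single 0 d))
    {b : (Fin (m + 1) →₀ ℕ) → V} (hb : weightedNorm r b ≠ ⊤) :
    ∃ q : (Fin (m + 1) →₀ ℕ) → V, weightedNorm r q ≠ ⊤ ∧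
      ∀ α, q α + shiftDown d (cauchyProd c q) α = b α := by
  obtain ⟨w, hw0, hw⟩ : ∃ w : ℕ → (Fin (m + 1) →₀ ℕ) → V, w 0 = b ∧
      ∀ j, w (j + 1) = -shiftDown d (cauchyProd c (w j)) :=
    ⟨fun j => (fun u => -shiftDown d (cauchyProd c u))^[j] b, rfl,
      fun j => Function.iterate_succ_apply' _ _ _⟩
  have hT (u : (Fin (m + 1) →₀ ℕ) → V) :
      weightedNorm r (-shiftDown d (cauchyProd c u)) ≤ 2⁻¹ * weightedNorm r u := by
    have h0 := weight_ne_zero hr (Finsupp.single 0 d)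
    have h1 := weight_ne_top r (Finsupp.single 0 d)
    have h2 : weightedNorm r (-shiftDown d (cauchyProd c u)) =
        weightedNorm r (shiftDown d (cauchyProd c u)) := by
      simp [weightedNorm]
    rw [h2, ← ENNReal.mul_le_mul_iff_right h0 h1]
    calc _ ≤ _ := weight_mul_weightedNorm_shiftDown_le r d _
      _ ≤ _ := weightedNorm_cauchyProd_le r c u
      _ ≤ 2⁻¹ * weight r (Finsupp.single 0 d) * weightedNorm r u := by gcongr
      _ = _ := by ring
  have hwN (j : ℕ) : weightedNorm r (w j) ≤ 2⁻¹ ^ j * weightedNorm r b := by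
    induction j with
    | zero => simp [hw0]
    | succ j ih =>
      rw [hw]
      refine (hT _).trans ?_
      rw [pow_succ', mul_assoc]
      gcongr
  have hsumN : ∑' j, weightedNorm r (w j) ≠ ⊤ := by
    refine ne_top_of_le_ne_top ?_ (ENNReal.tsum_le_tsum hwN)
    rw [ENNReal.tsum_mul_right]
    refine ENNReal.mul_ne_top ?_ hb
    rw [ENNReal.tsum_geometric]
    simp
  have hsumm (α) : Summable fun j => w j α := by
    have h1 : ∑' j, ‖w j α‖ₑ ≠ ⊤ := by
      have h0 := weight_ne_zero hr α
      have h1 := weight_ne_top r α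
      have h3 : (∑' j, ‖w j α‖ₑ) * weight r α ≠ ⊤ := by
        rw [← ENNReal.tsum_mul_right]
        refine ne_top_of_le_ne_top hsumN (ENNReal.tsum_le_tsum fun j => ?_)
        exact ENNReal.le_tsum (f := fun α => ‖w j α‖ₑ * weight r α) α
      intro h
      rw [h, ENNReal.top_mul h0] at h3
      exact h3 rfl
    refine Summable.of_norm ?_
    have h2 : Summable fun j => ‖w j α‖₊ := ENNReal.tsum_coe_ne_top_iff_summable.1 h1
    exact NNReal.summable_coe.2 h2
  refine ⟨fun α => ∑' j, w j α, ?_, fun α => ?_⟩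
  · refine ne_top_of_le_ne_top hsumN ?_
    calc _ ≤ ∑' α, ∑' j, ‖w j α‖ₑ * weight r α := by
          refine ENNReal.tsum_le_tsum fun α => ?_
          rw [ENNReal.tsum_mul_right]
          gcongr
          exact enorm_tsum_le_tsum_enorm
      _ = _ := ENNReal.tsum_comm
  · have h1 : HasSum (fun j => shiftDown d (cauchyProd c (w j)) α)
        (shiftDown d (cauchyProd c fun α => ∑' j, w j α) α) := by
      refine hasSum_sum fun x _ => ?_
      exact (hsumm x.2).hasSum.const_smul (c x.1)
    have h2 : HasSum (fun j => w (j + 1) α)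
        (-shiftDown d (cauchyProd c fun α => ∑' j, w j α) α) := by
      simpa only [hw, Pi.neg_apply] using h1.neg
    have h3 := (hsumm α).tsum_eq_zero_add
    rw [h2.tsum_eq, hw0] at h3
    change (∑' j, w j α) + _ = _
    rw [h3]
    abel

lemma HasExpansion.eventually_eq_sum [CompleteSpace V] {f : (Fin (m + 1) → ℂ) → V}
    {a : (Fin (m + 1) →₀ ℕ) → V} (h : HasExpansion f a) {d : ℕ}
    (hd : ∀ α, a (α + Finsupp.single 0 d) = 0) :
    ∃ P : Fin d → (Fin m → ℂ) → V, (∀ i, AnalyticAt ℂ (P i) 0) ∧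
      ∀ᶠ z in 𝓝 0, f z = ∑ i : Fin d, z 0 ^ (i : ℕ) • P i (Fin.tail z) := by
  have hconv (i : ℕ) : IsConvergent fun β => a (Finsupp.cons i β) := by
    obtain ⟨r, hr, hN⟩ := h.1
    refine ⟨Fin.tail r, fun j => hr _, ?_⟩
    have h1 : (r 0 : ℝ≥0∞) ^ i * weightedNorm (Fin.tail r) (fun β => a (Finsupp.cons i β)) ≠ ⊤ := by
      refine ne_top_of_le_ne_top hN ?_
      rw [weightedNorm, ← ENNReal.tsum_mul_left]
      refine le_trans (le_of_eq (tsum_congr fun β => ?_))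
        (ENNReal.tsum_comp_le_tsum_of_injective (Finsupp.cons_right_injective i)
          (fun α => ‖a α‖ₑ * weight r α))
      rw [weight_cons]
      ring
    intro h2
    rw [h2, ENNReal.mul_top] at h1
    · exact h1 rfl
    · exact pow_ne_zero _ (by simpa using (hr 0).ne')
  refine ⟨fun i z => ∑' β, monom z β • a (Finsupp.cons i β),
    fun i => (hconv i).hasExpansion.analyticAt, ?_⟩
  have htail : Tendsto (Fin.tail : (Fin (m + 1) → ℂ) → Fin m → ℂ) (𝓝 0) (𝓝 0) := by
    have : Continuous (Fin.tail : (Fin (m + 1) → ℂ) → Fin m → ℂ) := by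
      unfold Fin.tail
      fun_prop
    exact this.tendsto 0
  have hP : ∀ᶠ z : Fin (m + 1) → ℂ in 𝓝 0, ∀ i : Fin d,
      HasSum (fun β => monom (Fin.tail z) β • a (Finsupp.cons i β))
        (∑' β, monom (Fin.tail z) β • a (Finsupp.cons i β)) :=
    eventually_all.2 fun i => htail.eventually (hconv i).hasExpansion.2
  filter_upwards [h.2, hP] with z h1 h2
  let e : Fin d × (Fin m →₀ ℕ) → (Fin (m + 1) →₀ ℕ) := fun x => Finsupp.cons x.1 x.2
  have he : Function.Injective e := by
    rintro ⟨i, β⟩ ⟨j, γ⟩ hij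
    have h3 : (i : ℕ) = j := by simpa [e] using DFunLike.congr_fun hij 0
    have h4 : β = γ := by simpa [e] using congrArg Finsupp.tail hij
    rw [Fin.ext h3, h4]
  rw [← he.hasSum_iff] at h1
  · have h3 := h1.prod_fiberwise (g := fun i : Fin d =>
      z 0 ^ (i : ℕ) • ∑' β, monom (Fin.tail z) β • a (Finsupp.cons i β)) fun i => by
        simpa only [e, Function.comp_def, monom_cons, mul_smul] using
          (h2 i).const_smul (z 0 ^ (i : ℕ))
    exact h3.unique (hasSum_fintype _)
  · intro α hα
    have h3 : d ≤ α 0 := by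
      by_contra! h4
      exact hα ⟨(⟨α 0, h4⟩, α.tail), by simp [e]⟩
    have h5 : Finsupp.single 0 d ≤ α := by simpa using h3
    rw [← tsub_add_cancel_of_le h5, hd, smul_zero]

end Weierstrass

section Weierstrass

variable {m : ℕ} {V : Type*} [NormedAddCommGroup V] [NormedSpace ℂ V]

lemma weierstrass_division_of_monic [CompleteSpace V] {h : (Fin (m + 1) → ℂ) → ℂ}
    {c : (Fin (m + 1) →₀ ℕ) → ℂ} (hh : HasExpansion h c) (hc0 : ∀ i, c (Finsupp.single 0 i) = 0)
    (d : ℕ) {f : (Fin (m + 1) → ℂ) → V} (hf : AnalyticAt ℂ f 0) :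
    ∃ (Q : (Fin (m + 1) → ℂ) → V) (P : Fin d → (Fin m → ℂ) → V), AnalyticAt ℂ Q 0 ∧
      (∀ i, AnalyticAt ℂ (P i) 0) ∧
      ∀ᶠ z in 𝓝 0, f z = (z 0 ^ d + h z) • Q z + ∑ i : Fin d, z 0 ^ (i : ℕ) • P i (Fin.tail z) := by
  obtain ⟨a, ha⟩ := hf.exists_hasExpansion
  obtain ⟨s, hs, hsN⟩ : ∃ s : ℝ≥0, 0 < s ∧ weightedNorm (fun _ => s) c ≠ ⊤ ∧
      weightedNorm (fun _ => s) a ≠ ⊤ := by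
    obtain ⟨s, hs, h1⟩ := hh.1.exists_const
    obtain ⟨t, ht, h2⟩ := ha.1.exists_const
    exact ⟨min s t, lt_min hs ht,
      ne_top_of_le_ne_top h1 (weightedNorm_mono (fun _ => min_le_left _ _) _),
      ne_top_of_le_ne_top h2 (weightedNorm_mono (fun _ => min_le_right _ _) _)⟩
  obtain ⟨r, hr, hr0, hrs, hrc⟩ := exists_radii_weightedNorm_le hc0 hs hsN.1
    (ε := 2⁻¹ * (s : ℝ≥0∞) ^ d) (by simp [hs.ne'])
  have hra : weightedNorm r (shiftDown d a) ≠ ⊤ := by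
    intro h1
    have h2 := weight_mul_weightedNorm_shiftDown_le r d a
    rw [h1, ENNReal.mul_top (weight_ne_zero hr _), top_le_iff] at h2
    exact ne_top_of_le_ne_top hsN.2 (weightedNorm_mono hrs a) h2
  obtain ⟨q, hq, hqeq⟩ := exists_add_shiftDown_cauchyProd_eq hr
    (by rwa [weight_single, hr0]) hra
  have hQ : HasExpansion (fun z => ∑' α, monom z α • q α) q := IsConvergent.hasExpansion ⟨r, hr, hq⟩
  set Q : (Fin (m + 1) → ℂ) → V := fun z => ∑' α, monom z α • q α with hQdef
  have hrem := ha.add (((hQ.monom_smul (Finsupp.single 0 d)).add (hh.smul hQ)).clm_comp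
    (-ContinuousLinearMap.id ℂ V))
  obtain ⟨P, hP, hPe⟩ := hrem.eventually_eq_sum (d := d) fun α => by
    have := hqeq α
    simp only [shiftDown] at this
    simp only [shiftUp_add, neg_apply, ContinuousLinearMap.id_apply]
    rw [this]
    abel
  refine ⟨Q, P, hQ.analyticAt, hP, ?_⟩
  filter_upwards [hPe] with z hz
  rw [← hz]
  simp only [neg_apply, ContinuousLinearMap.id_apply, monom_single, add_smul]
  abel

lemma exists_monic_factor {g : (Fin (m + 1) → ℂ) → ℂ} {γ : (Fin (m + 1) →₀ ℕ) → ℂ}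
    (hg : HasExpansion g γ) {d : ℕ} (hd : γ (Finsupp.single 0 d) ≠ 0)
    (hlt : ∀ i < d, γ (Finsupp.single 0 i) = 0) :
    ∃ (u h : (Fin (m + 1) → ℂ) → ℂ) (c : (Fin (m + 1) →₀ ℕ) → ℂ), AnalyticAt ℂ u 0 ∧
      u 0 ≠ 0 ∧ HasExpansion h c ∧ (∀ i, c (Finsupp.single 0 i) = 0) ∧
      ∀ᶠ z in 𝓝 0, g z = u z * (z 0 ^ d + h z) := by
  have hconv : IsConvergent (shiftDown d γ) := by
    obtain ⟨r, hr, hN⟩ := hg.1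
    refine ⟨r, hr, fun h1 => ?_⟩
    have h2 := weight_mul_weightedNorm_shiftDown_le r d γ
    rw [h1, ENNReal.mul_top (weight_ne_zero hr _), top_le_iff] at h2
    exact hN h2
  have hu := hconv.hasExpansion
  set u : (Fin (m + 1) → ℂ) → ℂ := fun z => ∑' α, monom z α • shiftDown d γ α with hudef
  have hu0 : u 0 ≠ 0 := by
    have h1 : u 0 = shiftDown d γ 0 := by
      rw [hudef]
      dsimp only
      rw [tsum_eq_single 0]
      · simp [monom_zero]
      · intro α hα
        obtain ⟨i, hi⟩ := Finsupp.ne_iff.1 hα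
        have : monom (0 : Fin (m + 1) → ℂ) α = 0 :=
          Finset.prod_eq_zero (Finset.mem_univ i) (by simpa using hi)
        rw [this, zero_smul]
    rw [h1]
    simpa [shiftDown] using hd
  have hB := hg.add ((hu.monom_smul (Finsupp.single 0 d)).clm_comp (-ContinuousLinearMap.id ℂ ℂ))
  obtain ⟨ν, hν⟩ := (hu.analyticAt.inv hu0).exists_hasExpansion
  refine ⟨u, _, _, hu.analyticAt, hu0, hB.smul hν, fun i => ?_, ?_⟩
  · refine Finset.sum_eq_zero fun x hx => ?_
    have h1 := Finset.HasAntidiagonal.mem_antidiagonal.1 hx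
    have h2 : x.1 = Finsupp.single 0 (x.1 0) := by
      ext j
      refine Fin.cases ?_ (fun j => ?_) j
      · simp
      · have := DFunLike.congr_fun h1 j.succ
        rw [Finsupp.add_apply, Finsupp.single_eq_of_ne (Fin.succ_ne_zero j)] at this
        rw [Finsupp.single_eq_of_ne (Fin.succ_ne_zero j)]
        omega
    rw [h2]
    convert zero_smul ℂ _
    set k := x.1 0
    dsimp only
    by_cases hk : k < d
    · rw [hlt k hk, shiftUp_of_notMem_range]
      · simp
      · rintro ⟨β, hβ⟩
        have := DFunLike.congr_fun hβ 0
        simp at this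
        omega
    · have h3 : Finsupp.single (0 : Fin (m + 1)) k =
          Finsupp.single 0 (k - d) + Finsupp.single 0 d := by
        rw [← Finsupp.single_add]
        congr 1
        omega
      rw [h3, shiftUp_add]
      simp [shiftDown]
  · filter_upwards [hu.analyticAt.continuousAt.eventually_ne hu0] with z hz
    simp only [neg_apply, ContinuousLinearMap.id_apply, monom_single,
      smul_eq_mul, Pi.inv_apply]
    have hz' : u z ≠ 0 := hz
    field_simp
    simp only [hudef, smul_eq_mul]
    ring

lemma weierstrass_division_of_regular [CompleteSpace V] {g : (Fin (m + 1) → ℂ) → ℂ}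
    {γ : (Fin (m + 1) →₀ ℕ) → ℂ}
    (hg : HasExpansion g γ) {d : ℕ} (hd : γ (Finsupp.single 0 d) ≠ 0)
    (hlt : ∀ i < d, γ (Finsupp.single 0 i) = 0)
    {f : (Fin (m + 1) → ℂ) → V} (hf : AnalyticAt ℂ f 0) :
    ∃ (Q : (Fin (m + 1) → ℂ) → V) (P : Fin d → (Fin m → ℂ) → V), AnalyticAt ℂ Q 0 ∧
      (∀ i, AnalyticAt ℂ (P i) 0) ∧
      ∀ᶠ z in 𝓝 0, f z = g z • Q z + ∑ i : Fin d, z 0 ^ (i : ℕ) • P i (Fin.tail z) := by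
  obtain ⟨u, h, c, hu, hu0, hh, hc0, hgu⟩ := exists_monic_factor hg hd hlt
  obtain ⟨Q, P, hQ, hP, hQP⟩ := weierstrass_division_of_monic hh hc0 d hf
  refine ⟨fun z => (u z)⁻¹ • Q z, P, (hu.inv hu0).smul hQ, hP, ?_⟩
  filter_upwards [hgu, hQP, hu.continuousAt.eventually_ne hu0] with z h1 h2 h3
  rw [h2, h1, smul_smul, mul_assoc, mul_comm (_ + _) (u z)⁻¹, mul_inv_cancel_left₀ h3]

lemma exists_regular_coordinates {ζ : Fin (m + 1) → ℂ} {g : (Fin (m + 1) → ℂ) → ℂ}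
    (hg : AnalyticAt ℂ g ζ) (hne : ¬ ∀ᶠ z in 𝓝 ζ, g z = 0) :
    ∃ (L : (Fin (m + 1) → ℂ) ≃L[ℂ] (Fin (m + 1) → ℂ)) (γ : (Fin (m + 1) →₀ ℕ) → ℂ) (d : ℕ),
      HasExpansion (fun z => g (ζ + L z)) γ ∧ γ (Finsupp.single 0 d) ≠ 0 ∧
      ∀ i < d, γ (Finsupp.single 0 i) = 0 := by
  obtain ⟨L, hL⟩ : ∃ L : (Fin (m + 1) → ℂ) ≃L[ℂ] (Fin (m + 1) → ℂ),
      ¬ ∀ᶠ t : ℂ in 𝓝 0, g (ζ + L (Pi.single 0 t)) = 0 := by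
    obtain ⟨ε, hε, hball⟩ := Metric.eventually_nhds_iff_ball.1 hg.eventually_analyticAt
    obtain ⟨w, hw, hw0⟩ : ∃ w ∈ Metric.ball ζ ε, g w ≠ 0 := by
      by_contra! h
      exact hne (Metric.eventually_nhds_iff_ball.2 ⟨ε, hε, h⟩)
    by_cases hwζ : w = ζ
    · refine ⟨ContinuousLinearEquiv.refl ℂ _, fun h => hw0 ?_⟩
      simpa [hwζ] using h.self_of_nhds
    obtain ⟨L, hL⟩ := SeparatingDual.exists_continuousLinearEquiv_apply_eq (R := ℂ)
      (x := (Pi.single 0 1 : Fin (m + 1) → ℂ)) (y := w - ζ)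
      (by simp) (sub_ne_zero.2 hwζ)
    have hLt (t : ℂ) : L (Pi.single 0 t) = t • (w - ζ) := by
      rw [← hL, ← map_smul]
      congr 1
      ext j
      simp [Pi.single_apply]
    refine ⟨L, fun h => hw0 ?_⟩
    let k : ℂ → ℂ := fun t => g (ζ + t • (w - ζ))
    let U : Set ℂ := (fun t : ℂ => ζ + t • (w - ζ)) ⁻¹' Metric.ball ζ ε
    have hU : Convex ℝ U := by
      intro s hs t ht a b ha hb hab
      have := convex_ball ζ ε hs ht ha hb hab
      simp only [U, Set.mem_preimage] at this ⊢
      convert this using 1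
      ext j
      simp only [Pi.add_apply, Pi.smul_apply, smul_eq_mul, Complex.real_smul]
      have hab' : (a : ℂ) + b = 1 := by exact_mod_cast hab
      linear_combination (-ζ j) * hab'
    have hk : AnalyticOnNhd ℂ k U := fun t ht =>
      AnalyticAt.comp (g := g) (hball _ ht)
        (analyticAt_const.add (analyticAt_id.smul analyticAt_const))
    have h0 : (0 : ℂ) ∈ U := by simp [U, hε]
    have h1 : (1 : ℂ) ∈ U := by simpa [U] using hw
    have := hk.eqOn_zero_of_preconnected_of_eventuallyEq_zero hU.isPreconnected h0
      (by simp only [hLt] at h; exact h) h1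
    simpa [k] using this
  have hgL : AnalyticAt ℂ (fun z => g (ζ + L z)) 0 := by
    refine AnalyticAt.comp (g := g) (by simpa using hg) ?_
    exact analyticAt_const.add ((L : (Fin (m + 1) → ℂ) →L[ℂ] (Fin (m + 1) → ℂ)).analyticAt 0)
  obtain ⟨γ, hγ⟩ := hgL.exists_hasExpansion
  have hex : ∃ d, γ (Finsupp.single 0 d) ≠ 0 := by
    by_contra! h
    apply hL
    have ht : Tendsto (fun t : ℂ => (Pi.single 0 t : Fin (m + 1) → ℂ)) (𝓝 0) (𝓝 0) := by
      have : Continuous (fun t : ℂ => (Pi.single 0 t : Fin (m + 1) → ℂ)) :=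
        (ContinuousLinearMap.single ℂ (fun _ : Fin (m + 1) => ℂ) 0).continuous
      simpa using this.tendsto 0
    filter_upwards [ht.eventually hγ.2] with t h1
    refine h1.unique ?_
    convert hasSum_zero with α
    by_cases hα : ∃ i : Fin m, α i.succ ≠ 0
    · obtain ⟨i, hi⟩ := hα
      have : monom (Pi.single 0 t : Fin (m + 1) → ℂ) α = 0 :=
        Finset.prod_eq_zero (Finset.mem_univ i.succ) (by simp [hi])
      rw [this, zero_smul]
    · push Not at hα
      have : α = Finsupp.single 0 (α 0) := by
        ext i
        refine Fin.cases ?_ (fun j => ?_) i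
        · simp
        · rw [hα j, Finsupp.single_eq_of_ne (Fin.succ_ne_zero j)]
      rw [this, h, smul_zero]
  classical
  exact ⟨L, γ, Nat.find hex, hγ, Nat.find_spec hex, fun i hi => not_not.1 (Nat.find_min hex hi)⟩

end Weierstrass

section Germs

variable {Y : Type*} [NormedAddCommGroup Y] [NormedSpace ℂ Y] {η : Y}
  {Z : Type*} [NormedAddCommGroup Z] [NormedSpace ℂ Z]
  {V : Type*} [NormedAddCommGroup V] [NormedSpace ℂ V]
  {F : Type*} [NormedAddCommGroup F] [NormedSpace ℂ F]

/-- The germ at `η` of a scalar function analytic at `η`, as an element of `O_η`. -/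
noncomputable def scalarGerm (f : Y → ℂ) (hf : AnalyticAt ℂ f η) : Oat Y η :=
  ⟨(↑f : Filter.Germ (𝓝 η) ℂ), f, hf, rfl⟩

lemma exists_scalarGerm (a : Oat Y η) : ∃ f, ∃ hf : AnalyticAt ℂ f η, a = scalarGerm f hf := by
  obtain ⟨-, f, hf, rfl⟩ := a
  exact ⟨f, hf, rfl⟩

lemma exists_germOf (a : OEat Y V η) : ∃ f, ∃ hf : AnalyticAt ℂ f η, a = germOf Y V η f hf := by
  obtain ⟨-, f, hf, rfl⟩ := a
  exact ⟨f, hf, rfl⟩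

lemma scalarGerm_eq_iff {f g : Y → ℂ} {hf : AnalyticAt ℂ f η} {hg : AnalyticAt ℂ g η} :
    scalarGerm f hf = scalarGerm g hg ↔ f =ᶠ[𝓝 η] g := by
  exact Subtype.ext_iff.trans Germ.coe_eq

lemma germOf_eq_iff {f g : Y → V} {hf : AnalyticAt ℂ f η} {hg : AnalyticAt ℂ g η} :
    germOf Y V η f hf = germOf Y V η g hg ↔ f =ᶠ[𝓝 η] g := by
  exact Subtype.ext_iff.trans Germ.coe_eq

lemma scalarGerm_eq_zero_iff {f : Y → ℂ} {hf : AnalyticAt ℂ f η} :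
    scalarGerm f hf = 0 ↔ ∀ᶠ z in 𝓝 η, f z = 0 :=
  scalarGerm_eq_iff (hg := analyticAt_const)

lemma scalarGerm_add {f g : Y → ℂ} (hf : AnalyticAt ℂ f η) (hg : AnalyticAt ℂ g η) :
    scalarGerm f hf + scalarGerm g hg = scalarGerm (fun z => f z + g z) (hf.add hg) := rfl

lemma scalarGerm_mul {f g : Y → ℂ} (hf : AnalyticAt ℂ f η) (hg : AnalyticAt ℂ g η) :
    scalarGerm f hf * scalarGerm g hg = scalarGerm (fun z => f z * g z) (hf.mul hg) := rfl

lemma scalarGerm_pow {f : Y → ℂ} (hf : AnalyticAt ℂ f η) (n : ℕ) :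
    scalarGerm f hf ^ n = scalarGerm (fun z => f z ^ n) (hf.pow n) := rfl

lemma germOf_add {f g : Y → V} (hf : AnalyticAt ℂ f η) (hg : AnalyticAt ℂ g η) :
    germOf Y V η f hf + germOf Y V η g hg = germOf Y V η (fun z => f z + g z) (hf.add hg) := rfl

lemma scalarGerm_smul_germOf {a : Y → ℂ} {f : Y → V} (ha : AnalyticAt ℂ a η)
    (hf : AnalyticAt ℂ f η) :
    scalarGerm a ha • germOf Y V η f hf = germOf Y V η (fun z => a z • f z) (ha.smul hf) := rfl

lemma germOf_sum {ι : Type*} (s : Finset ι) {f : ι → Y → V} (hf : ∀ i, AnalyticAt ℂ (f i) η) :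
    ∑ i ∈ s, germOf Y V η (f i) (hf i) = germOf Y V η (fun z => ∑ i ∈ s, f i z)
      (Finset.analyticAt_fun_sum s fun i _ => hf i) := by
  classical
  induction s using Finset.induction_on with
  | empty => simp only [Finset.sum_empty]; rfl
  | insert i s hi ih => simp only [Finset.sum_insert hi, ih, germOf_add]

lemma scalarGerm_sum {ι : Type*} (s : Finset ι) {f : ι → Y → ℂ} (hf : ∀ i, AnalyticAt ℂ (f i) η) :
    ∑ i ∈ s, scalarGerm (f i) (hf i) = scalarGerm (fun z => ∑ i ∈ s, f i z)
      (Finset.analyticAt_fun_sum s fun i _ => hf i) := by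
  classical
  induction s using Finset.induction_on with
  | empty => simp only [Finset.sum_empty]; rfl
  | insert i s hi ih => simp only [Finset.sum_insert hi, ih, scalarGerm_add]

lemma scalarGerm_mem_mIdeal {f : Y → ℂ} {hf : AnalyticAt ℂ f η} :
    scalarGerm f hf ∈ mIdeal Y η ↔ f η = 0 := Iff.rfl

/-- Constant germs, as a ring homomorphism. -/
noncomputable def constHom (η : Y) : ℂ →+* Oat Y η where
  toFun c := scalarGerm (fun _ => c) analyticAt_const
  map_one' := rfl
  map_mul' _ _ := rfl
  map_zero' := rfl
  map_add' _ _ := rfl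

lemma constHom_apply (c : ℂ) :
    constHom η c = scalarGerm (fun _ => c) analyticAt_const := rfl

lemma evalAt_constHom (c : ℂ) : evalAt Y η (constHom η c) = c := rfl

lemma sub_constHom_evalAt_mem (a : Oat Y η) : a - constHom η (evalAt Y η a) ∈ mIdeal Y η := by
  rw [mIdeal, RingHom.mem_ker, map_sub, evalAt_constHom, sub_self]

lemma isUnit_of_notMem_mIdeal {a : Oat Y η} (ha : a ∉ mIdeal Y η) : IsUnit a := by
  obtain ⟨f, hf, rfl⟩ := exists_scalarGerm a
  rw [scalarGerm_mem_mIdeal] at ha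
  refine IsUnit.of_mul_eq_one (scalarGerm _ (hf.inv ha)) ?_
  rw [scalarGerm_mul]
  refine scalarGerm_eq_iff (hg := analyticAt_const).2 ?_
  filter_upwards [hf.continuousAt.eventually_ne ha] with z hz using mul_inv_cancel₀ hz

instance : Nontrivial (Oat Y η) := (evalAt Y η).domain_nontrivial

lemma mIdeal_ne_top : mIdeal Y η ≠ ⊤ := RingHom.ker_ne_top _

instance : IsLocalRing (Oat Y η) := by
  refine IsLocalRing.of_nonunits_add fun a b ha hb => ?_
  have h (c : Oat Y η) (hc : c ∈ nonunits (Oat Y η)) : c ∈ mIdeal Y η := by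
    by_contra h1
    exact hc (isUnit_of_notMem_mIdeal h1)
  exact fun h1 => mIdeal_ne_top (Ideal.eq_top_of_isUnit_mem _ (add_mem (h a ha) (h b hb)) h1)

lemma mIdeal_le_jacobson : mIdeal Y η ≤ Ideal.jacobson ⊥ := by
  rw [IsLocalRing.jacobson_eq_maximalIdeal _ bot_ne_top]
  exact IsLocalRing.le_maximalIdeal mIdeal_ne_top

instance : NoZeroDivisors (Oat Y η) where
  eq_zero_or_eq_zero_of_mul_eq_zero {a b} hab := by
    obtain ⟨f, hf, rfl⟩ := exists_scalarGerm a
    obtain ⟨g, hg, rfl⟩ := exists_scalarGerm b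
    rw [scalarGerm_mul, scalarGerm_eq_zero_iff] at hab
    rw [scalarGerm_eq_zero_iff, scalarGerm_eq_zero_iff, or_iff_not_imp_right]
    intro hne
    obtain ⟨ε, hε, hball⟩ := Metric.eventually_nhds_iff_ball.1
      (hab.and (hf.eventually_analyticAt.and hg.eventually_analyticAt))
    obtain ⟨w, hw, hw0⟩ : ∃ w ∈ Metric.ball η ε, g w ≠ 0 := by
      by_contra! h
      exact hne (Metric.eventually_nhds_iff_ball.2 ⟨ε, hε, h⟩)
    have hfw : f =ᶠ[𝓝 w] 0 := by
      filter_upwards [Metric.isOpen_ball.mem_nhds hw,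
        (hball w hw).2.2.continuousAt.eventually_ne hw0] with z hz hz0
      exact (mul_eq_zero.1 (hball z hz).1).resolve_right hz0
    let _ : NormedSpace ℝ Y := NormedSpace.restrictScalars ℝ ℂ Y
    have hfo : AnalyticOnNhd ℂ f (Metric.ball η ε) := fun z hz => (hball z hz).2.1
    have := hfo.eqOn_zero_of_preconnected_of_eventuallyEq_zero
      (convex_ball η ε).isPreconnected hw hfw
    exact Metric.eventually_nhds_iff_ball.2 ⟨ε, hε, this⟩

instance : IsDomain (Oat Y η) := NoZeroDivisors.to_isDomain _

lemma AnalyticAt.apply_of_dual {L : Y → F →L[ℂ] ℂ} {f : Y → F} (hL : AnalyticAt ℂ L η)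
    (hf : AnalyticAt ℂ f η) : AnalyticAt ℂ (fun z => L z (f z)) η :=
  ((ContinuousLinearMap.id ℂ (F →L[ℂ] ℂ)).analyticAt_bilinear (L η, f η)).comp₂ hL hf

/-- Pairing of a family of functionals with a vector-valued germ. -/
noncomputable def pair (Ψ : OEat Y (F →L[ℂ] ℂ) η) : OEat Y F η →ₗ[Oat Y η] Oat Y η where
  toFun f := ⟨Ψ.1.map₂ (fun L v => L v) f.1, by
    obtain ⟨L, hL, rfl⟩ := exists_germOf Ψ
    obtain ⟨g, hg, rfl⟩ := exists_germOf f
    exact ⟨fun z => L z (g z), hL.apply_of_dual hg, rfl⟩⟩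
  map_add' f g := by
    obtain ⟨L, hL, rfl⟩ := exists_germOf Ψ
    obtain ⟨f, hf, rfl⟩ := exists_germOf f
    obtain ⟨g, hg, rfl⟩ := exists_germOf g
    refine scalarGerm_eq_iff (f := fun z => L z (f z + g z)) (g := fun z => L z (f z) + L z (g z))
      (hf := hL.apply_of_dual (hf.add hg))
      (hg := (hL.apply_of_dual hf).add (hL.apply_of_dual hg)).2 ?_
    exact .of_forall fun z => map_add _ _ _
  map_smul' a f := by
    obtain ⟨L, hL, rfl⟩ := exists_germOf Ψ
    obtain ⟨f, hf, rfl⟩ := exists_germOf f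
    obtain ⟨a, ha, rfl⟩ := exists_scalarGerm a
    refine scalarGerm_eq_iff (f := fun z => L z (a z • f z)) (g := fun z => a z * L z (f z))
      (hf := hL.apply_of_dual (ha.smul hf)) (hg := ha.mul (hL.apply_of_dual hf)).2 ?_
    exact .of_forall fun z => map_smul _ _ _

/-- Evaluation of a family of functionals at a fixed vector. -/
noncomputable def ap (e : F) : OEat Y (F →L[ℂ] ℂ) η →ₗ[Oat Y η] Oat Y η where
  toFun Ψ := pair Ψ (constGerm Y F η e)
  map_add' Ψ Φ := by
    obtain ⟨L, hL, rfl⟩ := exists_germOf Ψ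
    obtain ⟨M, hM, rfl⟩ := exists_germOf Φ
    rfl
  map_smul' a Ψ := by
    obtain ⟨L, hL, rfl⟩ := exists_germOf Ψ
    obtain ⟨a, ha, rfl⟩ := exists_scalarGerm a
    rfl

lemma ap_apply (e : F) (Ψ : OEat Y (F →L[ℂ] ℂ) η) : ap e Ψ = pair Ψ (constGerm Y F η e) := rfl

lemma ap_germOf {L : Y → F →L[ℂ] ℂ} (hL : AnalyticAt ℂ L η) (e : F) :
    ap e (germOf Y (F →L[ℂ] ℂ) η L hL) =
      scalarGerm (fun z => L z e) (hL.apply_of_dual analyticAt_const) := rfl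

lemma constGerm_add (e e' : F) :
    constGerm Y F η (e + e') = constGerm Y F η e + constGerm Y F η e' := rfl

lemma constGerm_smul (c : ℂ) (e : F) :
    constGerm Y F η (c • e) = constHom η c • constGerm Y F η e := rfl

section Pull

variable {π : Y → Z} {ξ : Z} (hπ : AnalyticAt ℂ π η) (hξ : π η = ξ)

/-- Composition of scalar germs with an analytic map germ. -/
noncomputable def pullScalar : Oat Z ξ →+* Oat Y η where
  toFun a := ⟨a.1.compTendsto π (hξ ▸ hπ.continuousAt), by
    obtain ⟨f, hf, rfl⟩ := exists_scalarGerm a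
    subst hξ
    exact ⟨f ∘ π, hf.comp hπ, rfl⟩⟩
  map_one' := rfl
  map_mul' a b := by
    obtain ⟨f, hf, rfl⟩ := exists_scalarGerm a
    obtain ⟨g, hg, rfl⟩ := exists_scalarGerm b
    rfl
  map_zero' := rfl
  map_add' a b := by
    obtain ⟨f, hf, rfl⟩ := exists_scalarGerm a
    obtain ⟨g, hg, rfl⟩ := exists_scalarGerm b
    rfl

/-- Composition of vector-valued germs with an analytic map germ. -/
noncomputable def pullGerm : OEat Z V ξ →ₛₗ[pullScalar hπ hξ] OEat Y V η where
  toFun a := ⟨a.1.compTendsto π (hξ ▸ hπ.continuousAt), by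
    obtain ⟨f, hf, rfl⟩ := exists_germOf a
    subst hξ
    exact ⟨f ∘ π, hf.comp hπ, rfl⟩⟩
  map_add' a b := by
    obtain ⟨f, hf, rfl⟩ := exists_germOf a
    obtain ⟨g, hg, rfl⟩ := exists_germOf b
    rfl
  map_smul' a b := by
    obtain ⟨f, hf, rfl⟩ := exists_scalarGerm a
    obtain ⟨g, hg, rfl⟩ := exists_germOf b
    rfl

lemma pullScalar_scalarGerm {f : Z → ℂ} (hf : AnalyticAt ℂ f ξ) :
    pullScalar hπ hξ (scalarGerm f hf) =
      scalarGerm (fun z => f (π z)) (AnalyticAt.comp (g := f) (hξ ▸ hf) hπ) := rfl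

lemma pullGerm_germOf {f : Z → V} (hf : AnalyticAt ℂ f ξ) :
    pullGerm hπ hξ (germOf Z V ξ f hf) =
      germOf Y V η (fun z => f (π z)) (AnalyticAt.comp (g := f) (hξ ▸ hf) hπ) := rfl

lemma ap_pullGerm (e : F) (Ψ : OEat Z (F →L[ℂ] ℂ) ξ) :
    ap e (pullGerm hπ hξ Ψ) = pullScalar hπ hξ (ap e Ψ) := by
  obtain ⟨L, hL, rfl⟩ := exists_germOf Ψ
  rfl

lemma pullScalar_mem_mIdeal {a : Oat Z ξ} (ha : a ∈ mIdeal Z ξ) :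
    pullScalar hπ hξ a ∈ mIdeal Y η := by
  obtain ⟨f, hf, rfl⟩ := exists_scalarGerm a
  rw [pullScalar_scalarGerm, scalarGerm_mem_mIdeal, hξ]
  exact ha

end Pull

end Germs

section WeierstrassGerms

universe v

variable {m : ℕ} {ζ : Fin (m + 1) → ℂ}
  {V : Type*} [NormedAddCommGroup V] [NormedSpace ℂ V]

lemma eventually_affine_symm (L : (Fin (m + 1) → ℂ) ≃L[ℂ] (Fin (m + 1) → ℂ))
    {p : (Fin (m + 1) → ℂ) → (Fin (m + 1) → ℂ) → Prop} (h : ∀ᶠ w in 𝓝 0, p (ζ + L w) w) :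
    ∀ᶠ z in 𝓝 ζ, p z (L.symm (z - ζ)) := by
  have ht : Tendsto (fun z => L.symm (z - ζ)) (𝓝 ζ) (𝓝 0) := by
    have : Continuous fun z => L.symm (z - ζ) := by fun_prop
    simpa using this.tendsto ζ
  filter_upwards [ht.eventually h] with z hz
  simpa using hz

lemma analyticAt_affine_symm (L : (Fin (m + 1) → ℂ) ≃L[ℂ] (Fin (m + 1) → ℂ)) :
    AnalyticAt ℂ (fun z => L.symm (z - ζ)) ζ :=
  (L.symm : (Fin (m + 1) → ℂ) →L[ℂ] (Fin (m + 1) → ℂ)).analyticAt _ |>.comp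
    (analyticAt_id.sub analyticAt_const)

lemma AnalyticAt.comp_affine {f : (Fin (m + 1) → ℂ) → V} (hf : AnalyticAt ℂ f ζ)
    (L : (Fin (m + 1) → ℂ) ≃L[ℂ] (Fin (m + 1) → ℂ)) :
    AnalyticAt ℂ (fun w => f (ζ + L w)) 0 := by
  refine AnalyticAt.comp (g := f) (by simpa using hf) ?_
  exact analyticAt_const.add ((L : (Fin (m + 1) → ℂ) →L[ℂ] (Fin (m + 1) → ℂ)).analyticAt 0)

/-- The first coordinate in an affine system of coordinates. -/
noncomputable def headCoord (ζ : Fin (m + 1) → ℂ)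
    (L : (Fin (m + 1) → ℂ) ≃L[ℂ] (Fin (m + 1) → ℂ)) (z : Fin (m + 1) → ℂ) : ℂ :=
  L.symm (z - ζ) 0

/-- All coordinates but the first in an affine system of coordinates. -/
noncomputable def tailCoord (ζ : Fin (m + 1) → ℂ)
    (L : (Fin (m + 1) → ℂ) ≃L[ℂ] (Fin (m + 1) → ℂ)) (z : Fin (m + 1) → ℂ) : Fin m → ℂ :=
  Fin.tail (L.symm (z - ζ))

variable (L : (Fin (m + 1) → ℂ) ≃L[ℂ] (Fin (m + 1) → ℂ))

lemma analyticAt_headCoord : AnalyticAt ℂ (headCoord ζ L) ζ :=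
  (ContinuousLinearMap.proj (R := ℂ) (φ := fun _ : Fin (m + 1) => ℂ) 0).analyticAt _ |>.comp
    (analyticAt_affine_symm L)

lemma analyticAt_tailCoord : AnalyticAt ℂ (tailCoord ζ L) ζ :=
  (ContinuousLinearMap.pi fun i : Fin m => ContinuousLinearMap.proj (R := ℂ)
    (φ := fun _ : Fin (m + 1) => ℂ) i.succ).analyticAt _ |>.comp (analyticAt_affine_symm L)

lemma headCoord_self : headCoord ζ L ζ = 0 := by simp [headCoord]

lemma tailCoord_self : tailCoord ζ L ζ = 0 := by
  ext i
  simp [tailCoord, Fin.tail]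

variable (ζ)

/-- The germ of the first coordinate. -/
noncomputable def headGerm : Oat (Fin (m + 1) → ℂ) ζ :=
  scalarGerm (headCoord ζ L) (analyticAt_headCoord L)

/-- The inclusion of the scalar germs which do not depend on the first coordinate. -/
noncomputable abbrev tailScalar : Oat (Fin m → ℂ) 0 →+* Oat (Fin (m + 1) → ℂ) ζ :=
  pullScalar (analyticAt_tailCoord L) (tailCoord_self L)

/-- The inclusion of the vector-valued germs which do not depend on the first coordinate. -/
noncomputable abbrev tailGerm :
    OEat (Fin m → ℂ) V 0 →ₛₗ[tailScalar ζ L] OEat (Fin (m + 1) → ℂ) V ζ :=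
  pullGerm (analyticAt_tailCoord L) (tailCoord_self L)

variable {ζ}

lemma headGerm_mem_mIdeal : headGerm ζ L ∈ mIdeal _ ζ := headCoord_self L

lemma exists_eq_headCoord_smul_add [CompleteSpace V] {f : (Fin (m + 1) → ℂ) → V}
    (hf : AnalyticAt ℂ f ζ) :
    ∃ (Q : (Fin (m + 1) → ℂ) → V) (P : (Fin m → ℂ) → V), AnalyticAt ℂ Q ζ ∧ AnalyticAt ℂ P 0 ∧
      ∀ᶠ z in 𝓝 ζ, f z = headCoord ζ L z • Q z + P (tailCoord ζ L z) := by
  obtain ⟨Q, P, hQ, hP, h⟩ := weierstrass_division_of_monic (m := m) (h := fun _ => 0)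
    (c := fun _ => 0) ⟨⟨fun _ => 1, by simp, by simp [weightedNorm]⟩, by simp⟩ (fun _ => rfl) 1
    (hf.comp_affine L)
  refine ⟨fun z => Q (L.symm (z - ζ)), P 0,
    AnalyticAt.comp (g := Q) (by simpa using hQ) (analyticAt_affine_symm L), hP 0, ?_⟩
  filter_upwards [eventually_affine_symm L (p := fun z w => f z = (w 0 ^ 1 + 0) • Q w +
    ∑ i : Fin 1, w 0 ^ (i : ℕ) • P i (Fin.tail w)) h] with z hz
  simpa only [Finset.univ_unique, Finset.sum_singleton, pow_one, add_zero, Fin.default_eq_zero,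
    Fin.val_zero, pow_zero, one_smul, headCoord, tailCoord] using hz

lemma mIdeal_le_headGerm_sup :
    mIdeal _ ζ ≤ Ideal.span {headGerm ζ L} ⊔ (mIdeal (Fin m → ℂ) 0).map (tailScalar ζ L) := by
  intro a ha
  obtain ⟨f, hf, rfl⟩ := exists_scalarGerm a
  obtain ⟨Q, P, hQ, hP, h⟩ := exists_eq_headCoord_smul_add L hf
  have hP0 : scalarGerm P hP ∈ mIdeal (Fin m → ℂ) 0 := by
    have := h.self_of_nhds
    rw [scalarGerm_mem_mIdeal] at ha
    rw [headCoord_self, tailCoord_self, ha, zero_smul, zero_add] at this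
    exact this.symm
  have : scalarGerm f hf = headGerm ζ L * scalarGerm Q hQ + tailScalar ζ L (scalarGerm P hP) :=
    (scalarGerm_eq_iff (hg := ((analyticAt_headCoord L).mul hQ).add
      (AnalyticAt.comp (g := P) ((tailCoord_self L).symm ▸ hP) (analyticAt_tailCoord L)))).2 h
  rw [this]
  exact add_mem (Ideal.mem_sup_left (Ideal.mul_mem_right _ _ (Ideal.mem_span_singleton_self _)))
    (Ideal.mem_sup_right (Ideal.mem_map_of_mem _ hP0))

/-- Division with remainder of degree less than `d` in the first coordinate. -/
theorem exists_weierstrass_division {g : Oat (Fin (m + 1) → ℂ) ζ} (hg : g ≠ 0) :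
    ∃ (L : (Fin (m + 1) → ℂ) ≃L[ℂ] (Fin (m + 1) → ℂ)) (d : ℕ),
      (∀ f : Oat (Fin (m + 1) → ℂ) ζ, ∃ (Q : Oat (Fin (m + 1) → ℂ) ζ)
        (P : Fin d → Oat (Fin m → ℂ) 0),
        f = g * Q + ∑ i : Fin d, headGerm ζ L ^ (i : ℕ) * tailScalar ζ L (P i)) ∧
      ∀ (V : Type v) [NormedAddCommGroup V] [NormedSpace ℂ V] [CompleteSpace V]
        (f : OEat (Fin (m + 1) → ℂ) V ζ), ∃ (Q : OEat (Fin (m + 1) → ℂ) V ζ)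
        (P : Fin d → OEat (Fin m → ℂ) V 0),
        f = g • Q + ∑ i : Fin d, headGerm ζ L ^ (i : ℕ) • tailGerm ζ L (P i) := by
  obtain ⟨g, hga, rfl⟩ := exists_scalarGerm g
  rw [ne_eq, scalarGerm_eq_zero_iff] at hg
  obtain ⟨L, γ, d, hγ, hd, hlt⟩ := exists_regular_coordinates hga hg
  refine ⟨L, d, fun f => ?_, fun V _ _ _ f => ?_⟩
  · obtain ⟨f, hf, rfl⟩ := exists_scalarGerm f
    obtain ⟨Q, P, hQ, hP, h⟩ := weierstrass_division_of_regular hγ hd hlt (hf.comp_affine L)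
    have hP' (i : Fin d) : AnalyticAt ℂ (fun z => P i (tailCoord ζ L z)) ζ :=
      AnalyticAt.comp (g := P i) ((tailCoord_self L).symm ▸ hP i) (analyticAt_tailCoord L)
    refine ⟨scalarGerm _ (AnalyticAt.comp (g := Q) (f := fun z => L.symm (z - ζ))
      (by simpa using hQ) (analyticAt_affine_symm L)), fun i => scalarGerm (P i) (hP i), ?_⟩
    simp only [headGerm, scalarGerm_pow, pullScalar_scalarGerm, scalarGerm_mul]
    rw [scalarGerm_sum _ (f := fun (i : Fin d) z =>
      headCoord ζ L z ^ (i : ℕ) * P i (tailCoord ζ L z))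
      fun i => ((analyticAt_headCoord L).pow i).mul (hP' i), scalarGerm_add,
      scalarGerm_eq_iff]
    exact eventually_affine_symm L (p := fun z w => f z = g z * Q w +
      ∑ i : Fin d, w 0 ^ (i : ℕ) * P i (Fin.tail w)) h
  · obtain ⟨f, hf, rfl⟩ := exists_germOf f
    obtain ⟨Q, P, hQ, hP, h⟩ := weierstrass_division_of_regular hγ hd hlt (hf.comp_affine L)
    have hP' (i : Fin d) : AnalyticAt ℂ (fun z => P i (tailCoord ζ L z)) ζ :=
      AnalyticAt.comp (g := P i) ((tailCoord_self L).symm ▸ hP i) (analyticAt_tailCoord L)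
    refine ⟨germOf _ _ _ _ (AnalyticAt.comp (g := Q) (f := fun z => L.symm (z - ζ))
      (by simpa using hQ) (analyticAt_affine_symm L)), fun i => germOf _ _ _ (P i) (hP i), ?_⟩
    simp only [headGerm, scalarGerm_pow, pullGerm_germOf, scalarGerm_smul_germOf]
    rw [germOf_sum _ (f := fun (i : Fin d) z =>
      headCoord ζ L z ^ (i : ℕ) • P i (tailCoord ζ L z))
      fun i => ((analyticAt_headCoord L).pow i).smul (hP' i), germOf_add,
      germOf_eq_iff]
    exact eventually_affine_symm L (p := fun z w => f z = g z • Q w +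
      ∑ i : Fin d, w 0 ^ (i : ℕ) • P i (Fin.tail w)) h

end WeierstrassGerms

section Hadamard

variable {V : Type*} [NormedAddCommGroup V] [NormedSpace ℂ V] [CompleteSpace V]

lemma germOf_mem_mIdeal_smul_top {m : ℕ} {ζ : Fin m → ℂ} {f : (Fin m → ℂ) → V}
    (hf : AnalyticAt ℂ f ζ) (h0 : f ζ = 0) :
    germOf (Fin m → ℂ) V ζ f hf ∈ mIdeal (Fin m → ℂ) ζ •
      (⊤ : Submodule (Oat (Fin m → ℂ) ζ) (OEat (Fin m → ℂ) V ζ)) := by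
  induction m with
  | zero =>
    have : germOf (Fin 0 → ℂ) V ζ f hf = 0 := by
      refine (germOf_eq_iff (hg := analyticAt_const (v := 0))).2 (.of_forall fun z => ?_)
      rw [Subsingleton.elim z ζ, h0]
    rw [this]
    exact zero_mem _
  | succ m ih =>
    let L := ContinuousLinearEquiv.refl ℂ (Fin (m + 1) → ℂ)
    obtain ⟨Q, P, hQ, hP, h⟩ := exists_eq_headCoord_smul_add L hf
    have hP0 : P 0 = 0 := by
      have := h.self_of_nhds
      rw [headCoord_self, tailCoord_self, h0, zero_smul, zero_add] at this
      exact this.symm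
    have : germOf _ _ _ f hf =
        headGerm ζ L • germOf _ _ _ Q hQ + tailGerm ζ L (germOf _ _ _ P hP) :=
      by
      rw [headGerm, pullGerm_germOf, scalarGerm_smul_germOf, germOf_add, germOf_eq_iff]
      exact h
    rw [this]
    refine add_mem (Submodule.smul_mem_smul (headGerm_mem_mIdeal L) trivial) ?_
    refine Submodule.smul_induction_on (ih hP hP0) (fun r hr x _ => ?_) fun x y hx hy => ?_
    · rw [map_smulₛₗ]
      exact Submodule.smul_mem_smul (pullScalar_mem_mIdeal _ _ hr) trivial
    · rw [map_add]
      exact add_mem hx hy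

lemma exists_constGerm_add_mem {m : ℕ} {ζ : Fin m → ℂ} (x : OEat (Fin m → ℂ) V ζ) :
    ∃ (e : V) (y : OEat (Fin m → ℂ) V ζ), x = constGerm _ V ζ e + y ∧
      y ∈ mIdeal (Fin m → ℂ) ζ •
        (⊤ : Submodule (Oat (Fin m → ℂ) ζ) (OEat (Fin m → ℂ) V ζ)) := by
  obtain ⟨f, hf, rfl⟩ := exists_germOf x
  refine ⟨f ζ, germOf _ _ _ (fun z => f z - f ζ) (hf.sub analyticAt_const), ?_,
    germOf_mem_mIdeal_smul_top _ (sub_self _)⟩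
  rw [constGerm, germOf_add, germOf_eq_iff]
  exact .of_forall fun z => by simp

end Hadamard

section Families

universe v

/-- The module structure on vector-valued germs, as a shortcut for instance search. -/
noncomputable abbrev germModule {Y : Type*} [NormedAddCommGroup Y] [NormedSpace ℂ Y] (η : Y)
    (V : Type*) [NormedAddCommGroup V] [NormedSpace ℂ V] : Module (Oat Y η) (OEat Y V η) :=
  Submodule.module _

/-- The scalar multiplication on vector-valued germs, as a shortcut for instance search. -/
noncomputable abbrev germSMul {Y : Type*} [NormedAddCommGroup Y] [NormedSpace ℂ Y] (η : Y)
    (V : Type*) [NormedAddCommGroup V] [NormedSpace ℂ V] : SMul (Oat Y η) (OEat Y V η) :=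
  (germModule η V).toSMul

attribute [local instance] germModule germSMul

lemma eq_zero_of_forall_ap_eq_zero {Y : Type*} [NormedAddCommGroup Y] [NormedSpace ℂ Y] {η : Y}
    {F : Type*} [NormedAddCommGroup F] [NormedSpace ℂ F] {Φ : OEat Y (F →L[ℂ] ℂ) η}
    (h : ∀ e, ap e Φ = 0) : Φ = 0 := by
  obtain ⟨L, hL, rfl⟩ := exists_germOf Φ
  refine (germOf_eq_iff (hg := analyticAt_const (v := 0))).2 ?_
  obtain ⟨ε, hε, hball⟩ := Metric.eventually_nhds_iff_ball.1 hL.eventually_analyticAt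
  refine Metric.eventually_nhds_iff_ball.2 ⟨ε, hε, fun z hz => ?_⟩
  ext e
  let _ : NormedSpace ℝ Y := NormedSpace.restrictScalars ℝ ℂ Y
  have hLe : AnalyticOnNhd ℂ (fun z => L z e) (Metric.ball η ε) :=
    fun w hw => (hball w hw).apply_of_dual analyticAt_const
  have he := h e
  rw [ap_germOf, scalarGerm_eq_zero_iff] at he
  exact hLe.eqOn_zero_of_preconnected_of_eventuallyEq_zero (convex_ball η ε).isPreconnected
    (Metric.mem_ball_self hε) he hz

/-- There are finitely many elements of `N` which generate, with holomorphic families of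
functionals as coefficients, all families whose evaluations lie in `N`. -/
def GeneratesFamilies {m : ℕ} (ζ : Fin m → ℂ) {q : ℕ}
    (N : Submodule (Oat (Fin m → ℂ) ζ) (Fin q → Oat (Fin m → ℂ) ζ)) : Prop :=
  ∃ (κ : Type) (_ : Fintype κ) (g : κ → Fin q → Oat (Fin m → ℂ) ζ), (∀ j, g j ∈ N) ∧
    ∀ (F : Type v) [NormedAddCommGroup F] [NormedSpace ℂ F]
      (Φ : Fin q → OEat (Fin m → ℂ) (F →L[ℂ] ℂ) ζ), (∀ e : F, (fun i => ap e (Φ i)) ∈ N) →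
      ∃ c : κ → OEat (Fin m → ℂ) (F →L[ℂ] ℂ) ζ, ∀ i, Φ i = ∑ j, g j i • c j

/-- The version of `GeneratesFamilies` for ideals. -/
def IdealGeneratesFamilies {m : ℕ} (ζ : Fin m → ℂ) (J : Ideal (Oat (Fin m → ℂ) ζ)) : Prop :=
  ∃ (κ : Type) (_ : Fintype κ) (g : κ → Oat (Fin m → ℂ) ζ), (∀ j, g j ∈ J) ∧
    ∀ (F : Type v) [NormedAddCommGroup F] [NormedSpace ℂ F]
      (Φ : OEat (Fin m → ℂ) (F →L[ℂ] ℂ) ζ), (∀ e : F, ap e Φ ∈ J) →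
      ∃ c : κ → OEat (Fin m → ℂ) (F →L[ℂ] ℂ) ζ, Φ = ∑ j, g j • c j

lemma generatesFamilies_of_ideals {m : ℕ} {ζ : Fin m → ℂ}
    (h : ∀ J, IdealGeneratesFamilies.{v} ζ J) {q : ℕ}
    (N : Submodule (Oat (Fin m → ℂ) ζ) (Fin q → Oat (Fin m → ℂ) ζ)) :
    GeneratesFamilies.{v} ζ N := by
  induction q with
  | zero => exact ⟨Empty, inferInstance, nofun, nofun, fun F _ _ Φ _ => ⟨nofun, nofun⟩⟩
  | succ q ih =>
    let R := Oat (Fin m → ℂ) ζ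
    let J : Ideal R := N.map (LinearMap.proj 0)
    let cons0 : (Fin q → R) →ₗ[R] (Fin (q + 1) → R) :=
      { toFun := fun y => Fin.cons 0 y
        map_add' := fun x y => by
          ext i
          refine Fin.cases ?_ (fun i => ?_) i <;> simp
        map_smul' := fun a y => by
          ext i
          refine Fin.cases ?_ (fun i => ?_) i <;> simp }
    obtain ⟨κ, _, a, haJ, ha⟩ := h J
    obtain ⟨κ', _, b, hbN, hb⟩ := ih (N.comap cons0)
    choose x hxN hx using haJ
    refine ⟨κ ⊕ κ', inferInstance, Sum.elim x fun j => cons0 (b j), ?_, fun F _ _ Φ hΦ => ?_⟩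
    · rintro (j | j)
      · exact hxN j
      · exact hbN j
    obtain ⟨c, hc⟩ := ha F (Φ 0) fun e => ⟨_, hΦ e, rfl⟩
    obtain ⟨c', hc'⟩ := hb F (fun i => Φ i.succ - ∑ j, x j i.succ • c j) fun e => by
      have h1 : (fun i => ap e (Φ i)) - ∑ j, ap e (c j) • x j ∈ N :=
        sub_mem (hΦ e) (sum_mem fun j _ => N.smul_mem _ (hxN j))
      change Fin.cons 0 _ ∈ N
      convert h1 using 1
      ext i : 1
      refine Fin.cases ?_ (fun i => ?_) i
      · have h2 : ap e (Φ 0) = ∑ j, ap e (c j) * x j 0 := by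
          rw [hc, map_sum]
          refine Finset.sum_congr rfl fun j _ => ?_
          rw [map_smul, ← hx j, smul_eq_mul, mul_comm]
          rfl
        simp [h2]
      · simp [mul_comm]
    refine ⟨Sum.elim c c', fun i => ?_⟩
    rw [Fintype.sum_sum_type]
    refine Fin.cases ?_ (fun i => ?_) i
    · simp only [Sum.elim_inl, Sum.elim_inr]
      have h3 : ∑ j, cons0 (b j) 0 • c' j = 0 :=
        Finset.sum_eq_zero fun j _ => Module.zero_smul (c' j)
      rw [h3, add_zero, hc]
      exact Finset.sum_congr rfl fun j _ => by rw [← hx j]; rfl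
    · simp only [Sum.elim_inl, Sum.elim_inr]
      exact sub_eq_iff_eq_add'.1 (hc' i)

theorem idealGeneratesFamilies {m : ℕ} (ζ : Fin m → ℂ) (J : Ideal (Oat (Fin m → ℂ) ζ)) :
    IdealGeneratesFamilies.{v} ζ J := by
  induction m with
  | zero =>
    by_cases hJ : J = ⊥
    · refine ⟨Empty, inferInstance, nofun, nofun, fun F _ _ Φ hΦ => ⟨nofun, ?_⟩⟩
      simpa using eq_zero_of_forall_ap_eq_zero fun e => by simpa [hJ] using hΦ e
    · obtain ⟨g, hgJ, hg⟩ := Submodule.exists_mem_ne_zero_of_ne_bot hJ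
      refine ⟨Unit, inferInstance, fun _ => 1, fun _ => ?_, fun F _ _ Φ _ => ⟨fun _ => Φ, by simp⟩⟩
      have hu : IsUnit g := by
        refine isUnit_of_notMem_mIdeal fun h => hg ?_
        obtain ⟨f, hf, rfl⟩ := exists_scalarGerm g
        refine scalarGerm_eq_zero_iff.2 (.of_forall fun z => ?_)
        rw [Subsingleton.elim z ζ]
        exact h
      rw [Ideal.eq_top_of_isUnit_mem J hgJ hu]
      trivial
  | succ m ih =>
    by_cases hJ : J = ⊥
    · refine ⟨Empty, inferInstance, nofun, nofun, fun F _ _ Φ hΦ => ⟨nofun, ?_⟩⟩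
      simpa using eq_zero_of_forall_ap_eq_zero fun e => by simpa [hJ] using hΦ e
    obtain ⟨g, hgJ, hg⟩ := Submodule.exists_mem_ne_zero_of_ne_bot hJ
    obtain ⟨L, d, -, hdiv⟩ := exists_weierstrass_division.{v} hg
    let N : Submodule (Oat (Fin m → ℂ) 0) (Fin d → Oat (Fin m → ℂ) 0) :=
      { carrier := {r | ∑ i : Fin d, headGerm ζ L ^ (i : ℕ) * tailScalar ζ L (r i) ∈ J}
        add_mem' := fun {r s} hr hs => by
          simpa [mul_add, Finset.sum_add_distrib] using add_mem hr hs
        zero_mem' := by simp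
        smul_mem' := fun a r hr => by
          have h1 : ∑ i : Fin d, headGerm ζ L ^ (i : ℕ) * tailScalar ζ L (a * r i) ∈ J := by
            convert J.mul_mem_left (tailScalar ζ L a) hr using 1
            rw [Finset.mul_sum]
            exact Finset.sum_congr rfl fun i _ => by rw [map_mul, mul_left_comm]
          exact h1 }
    obtain ⟨κ, _, r, hrN, hr⟩ := generatesFamilies_of_ideals (ih 0) N
    refine ⟨Option κ, inferInstance, fun j => j.elim g fun j =>
      ∑ i : Fin d, headGerm ζ L ^ (i : ℕ) * tailScalar ζ L (r j i), ?_, fun F _ _ Φ hΦ => ?_⟩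
    · rintro (_ | j)
      · exact hgJ
      · exact hrN j
    obtain ⟨Q, P, hQP⟩ := hdiv (F →L[ℂ] ℂ) Φ
    obtain ⟨c, hc⟩ := hr F P fun e => by
      have h1 : ap e Φ - g * ap e Q ∈ J := sub_mem (hΦ e) (J.mul_mem_right _ hgJ)
      have h2 : ap e Φ - g * ap e Q =
          ∑ i : Fin d, headGerm ζ L ^ (i : ℕ) * tailScalar ζ L (ap e (P i)) := by
        rw [hQP, map_add, map_smul, smul_eq_mul, add_sub_cancel_left, map_sum]
        refine Finset.sum_congr rfl fun i _ => ?_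
        rw [map_smul, smul_eq_mul, ap_pullGerm]
      rw [h2] at h1
      exact h1
    refine ⟨fun j => j.elim Q fun j => tailGerm ζ L (c j), ?_⟩
    rw [Fintype.sum_option, hQP]
    congr 1
    simp only [Option.elim_some]
    have h3 (i : Fin d) : headGerm ζ L ^ (i : ℕ) • tailGerm ζ L (P i) =
        ∑ j, (headGerm ζ L ^ (i : ℕ) * tailScalar ζ L (r j i)) • tailGerm ζ L (c j) := by
      rw [hc i, map_sum, Finset.smul_sum]
      refine Finset.sum_congr rfl fun j _ => ?_
      rw [map_smulₛₗ, smul_smul]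
    rw [Finset.sum_congr rfl fun i _ => h3 i, Finset.sum_comm]
    exact Finset.sum_congr rfl fun j _ => (Finset.sum_smul ..).symm

theorem generatesFamilies {m : ℕ} (ζ : Fin m → ℂ) {q : ℕ}
    (N : Submodule (Oat (Fin m → ℂ) ζ) (Fin q → Oat (Fin m → ℂ) ζ)) :
    GeneratesFamilies.{v} ζ N :=
  generatesFamilies_of_ideals (idealGeneratesFamilies ζ) N

instance {m : ℕ} (ζ : Fin m → ℂ) : IsNoetherianRing (Oat (Fin m → ℂ) ζ) := by
  rw [isNoetherianRing_iff_ideal_fg]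
  intro J
  obtain ⟨κ, _, g, hgJ, hg⟩ := idealGeneratesFamilies.{0} ζ J
  refine (Submodule.fg_iff_exists_finite_generating_family).2 ⟨κ, inferInstance, g, le_antisymm
    (Submodule.span_le.2 (Set.range_subset_iff.2 hgJ)) fun a ha => ?_⟩
  obtain ⟨f, hf, rfl⟩ := exists_scalarGerm a
  have hF : AnalyticAt ℂ (fun z => f z • ContinuousLinearMap.id ℂ ℂ) ζ := hf.smul analyticAt_const
  obtain ⟨c, hc⟩ := hg ℂ (germOf _ _ ζ _ hF) fun e => by
    convert J.mul_mem_right (constHom ζ e) ha using 1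
    rw [ap_germOf, constHom_apply, scalarGerm_mul, scalarGerm_eq_iff]
    exact .of_forall fun z => by simp
  have h1 : scalarGerm f hf = ap (1 : ℂ) (germOf _ _ ζ _ hF) := by
    rw [ap_germOf, scalarGerm_eq_iff]
    exact .of_forall fun z => by simp
  rw [h1, hc, map_sum]
  refine sum_mem fun j _ => ?_
  rw [map_smul, smul_eq_mul, mul_comm]
  exact Submodule.smul_mem _ _ (Submodule.subset_span ⟨j, rfl⟩)

end Families

section AutomaticContinuity

lemma tsum_weight_ne_top {m : ℕ} {r : ℝ≥0} (hr : r < 1) :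
    ∑' α : Fin m →₀ ℕ, weight (fun _ => r) α ≠ ⊤ := by
  induction m with
  | zero => simp [tsum_fintype, weight]
  | succ m ih =>
    let u : (Fin (m + 1) →₀ ℕ) → ℕ × (Fin m →₀ ℕ) := fun α => (α 0, α.tail)
    have hu : Function.Injective u := fun α β h => by
      rw [← Finsupp.cons_tail α, ← Finsupp.cons_tail β]
      exact congrArg (fun x : ℕ × (Fin m →₀ ℕ) => Finsupp.cons x.1 x.2) h
    have h1 (α : Fin (m + 1) →₀ ℕ) : weight (fun _ => r) α =
        (fun x : ℕ × (Fin m →₀ ℕ) => (r : ℝ≥0∞) ^ x.1 * weight (fun _ => r) x.2) (u α) := by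
      conv_lhs => rw [← Finsupp.cons_tail α, weight_cons]
      rfl
    rw [tsum_congr h1]
    refine ne_top_of_le_ne_top ?_ (ENNReal.tsum_comp_le_tsum_of_injective hu
      (fun x : ℕ × (Fin m →₀ ℕ) => (r : ℝ≥0∞) ^ x.1 * weight (fun _ => r) x.2))
    rw [ENNReal.tsum_prod']
    simp_rw [ENNReal.tsum_mul_left, ENNReal.tsum_mul_right]
    refine ENNReal.mul_ne_top ?_ ih
    rw [ENNReal.tsum_geometric]
    simpa [tsub_eq_zero_iff_le] using hr

/-- A sequence of functionals whose convolution with every bounded sequence of vectors grows at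
most geometrically consists of functionals bounded on the unit ball. -/
lemma bounded_of_convolution_growth {F : Type*} [NormedAddCommGroup F] (f : ℕ → F → ℂ)
    (h : ∀ e : ℕ → F, (∀ j, ‖e j‖ ≤ 1) → ∃ C R : ℝ, ∀ k,
      ‖∑ x ∈ Finset.HasAntidiagonal.antidiagonal k, f x.1 (e x.2)‖ ≤ C * R ^ k) (a : ℕ) :
    ∃ B, ∀ e, ‖e‖ ≤ 1 → ‖f a e‖ ≤ B := by
  induction a using Nat.strong_induction_on with
  | _ a ih =>
  by_contra! hpick
  choose pick hpick1 hpick using hpick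
  have ih' (i : ℕ) : ∃ B, 0 ≤ B ∧ (i < a → ∀ e, ‖e‖ ≤ 1 → ‖f i e‖ ≤ B) := by
    by_cases hi : i < a
    · obtain ⟨B, hB⟩ := ih i hi
      exact ⟨|B|, abs_nonneg _, fun _ e he => (hB e he).trans (le_abs_self _)⟩
    · exact ⟨0, le_rfl, fun h => absurd h hi⟩
  choose B hB0 hB using ih'
  let S := ∑ x ∈ Finset.range a, B (a - (x + 1))
  obtain ⟨e, he⟩ : ∃ e : ℕ → F, ∀ j, e j = pick ((j + a).factorial + S +
      ‖∑ i ∈ (Finset.range j).attach, f (j + a - i) (e i)‖) :=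
    ⟨wellFounded_lt.fix fun j u => pick ((j + a).factorial + S +
      ‖∑ i ∈ (Finset.range j).attach, f (j + a - i) (u i (Finset.mem_range.1 i.2))‖),
      fun j => wellFounded_lt.fix_eq _ j⟩
  have he1 (j : ℕ) : ‖e j‖ ≤ 1 := he j ▸ hpick1 _
  obtain ⟨C, R, hCR⟩ := h e he1
  have key (j : ℕ) : ((j + a).factorial : ℝ) ≤ C * R ^ (j + a) := by
    refine le_trans ?_ (hCR (j + a))
    rw [← Finset.Nat.sum_antidiagonal_swap]
    simp only [Prod.fst_swap, Prod.snd_swap]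
    rw [Finset.Nat.sum_antidiagonal_eq_sum_range_succ (fun p q => f q (e p)), Nat.succ_eq_add_one,
      add_assoc, Finset.sum_range_add, Finset.sum_range_succ']
    have h1 : ‖∑ x ∈ Finset.range a, f (j + a - (j + (x + 1))) (e (j + (x + 1)))‖ ≤ S := by
      refine (norm_sum_le _ _).trans (Finset.sum_le_sum fun x hx => ?_)
      have hx := Finset.mem_range.1 hx
      rw [Nat.add_sub_add_left]
      exact hB _ (by omega) _ (he1 _)
    have h2 := hpick ((j + a).factorial + S +
      ‖∑ i ∈ (Finset.range j).attach, f (j + a - i) (e i)‖)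
    rw [← he, Finset.sum_attach (Finset.range j) fun i => f (j + a - i) (e i)] at h2
    simp only [add_zero, Nat.add_sub_cancel_left]
    set P := ∑ i ∈ Finset.range j, f (j + a - i) (e i)
    set Q := ∑ x ∈ Finset.range a, f (j + a - (j + (x + 1))) (e (j + (x + 1)))
    have h3 : ‖f a (e j)‖ ≤ ‖P + (Q + f a (e j))‖ + ‖P‖ + ‖Q‖ := by
      calc ‖f a (e j)‖ = ‖P + (Q + f a (e j)) - P - Q‖ := by congr 1; ring
        _ ≤ _ := (norm_sub_le _ _).trans (by gcongr; exact norm_sub_le _ _)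
    linarith
  have hlim : Tendsto (fun n : ℕ => C * (R ^ n / n.factorial)) atTop (𝓝 (C * 0)) :=
    (FloorSemiring.tendsto_pow_div_factorial_atTop R).const_mul C
  rw [mul_zero] at hlim
  obtain ⟨n, hn, hn'⟩ := ((hlim.eventually_lt_const one_pos).and (eventually_ge_atTop a)).exists
  have h4 := key (n - a)
  rw [Nat.sub_add_cancel hn'] at h4
  rw [← mul_div_assoc, div_lt_one (by positivity)] at hn
  linarith

end AutomaticContinuity

section Taylor

variable {m : ℕ} {ζ : Fin m → ℂ}

lemma HasExpansion.unique {f : (Fin m → ℂ) → ℂ} {a b : (Fin m →₀ ℕ) → ℂ} (ha : HasExpansion f a)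
    (hb : HasExpansion f b) : a = b := by
  have h := (ha.add (hb.clm_comp (-ContinuousLinearMap.id ℂ ℂ))).congr
    (g := fun _ => 0) (.of_forall fun z => by simp)
  ext α
  simpa [← sub_eq_add_neg, sub_eq_zero] using congrFun h.eq_zero α

lemma tendsto_const_add_nhds_zero {Y : Type*} [NormedAddCommGroup Y] (η : Y) :
    Tendsto (fun w => η + w) (𝓝 0) (𝓝 η) := by
  have : Continuous fun w => η + w := by fun_prop
  simpa using this.tendsto 0

lemma exists_taylor (a : Oat (Fin m → ℂ) ζ) : ∃ c : (Fin m →₀ ℕ) → ℂ,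
    ∀ (f : (Fin m → ℂ) → ℂ) (hf : AnalyticAt ℂ f ζ), a = scalarGerm f hf →
      HasExpansion (fun w => f (ζ + w)) c := by
  obtain ⟨f, hf, rfl⟩ := exists_scalarGerm a
  have hf' : AnalyticAt ℂ (fun w => f (ζ + w)) 0 :=
    AnalyticAt.comp (g := f) (by simpa using hf) (analyticAt_const.add analyticAt_id)
  obtain ⟨c, hc⟩ := hf'.exists_hasExpansion
  refine ⟨c, fun g hg h => hc.congr ?_⟩
  exact (tendsto_const_add_nhds_zero ζ).eventually (scalarGerm_eq_iff.1 h)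

/-- The Taylor coefficients of a scalar germ. -/
noncomputable def taylor (a : Oat (Fin m → ℂ) ζ) : (Fin m →₀ ℕ) → ℂ := (exists_taylor a).choose

lemma hasExpansion_taylor {f : (Fin m → ℂ) → ℂ} (hf : AnalyticAt ℂ f ζ) :
    HasExpansion (fun w => f (ζ + w)) (taylor (scalarGerm f hf)) :=
  (exists_taylor (scalarGerm f hf)).choose_spec f hf rfl

lemma taylor_scalarGerm {f : (Fin m → ℂ) → ℂ} {hf : AnalyticAt ℂ f ζ} {c : (Fin m →₀ ℕ) → ℂ}
    (h : HasExpansion (fun w => f (ζ + w)) c) : taylor (scalarGerm f hf) = c :=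
  (hasExpansion_taylor hf).unique h

lemma isConvergent_taylor (a : Oat (Fin m → ℂ) ζ) : IsConvergent (taylor a) := by
  obtain ⟨f, hf, rfl⟩ := exists_scalarGerm a
  exact (hasExpansion_taylor hf).1

lemma taylor_injective : Function.Injective (taylor (ζ := ζ)) := by
  intro a b h
  obtain ⟨f, hf, rfl⟩ := exists_scalarGerm a
  obtain ⟨g, hg, rfl⟩ := exists_scalarGerm b
  rw [scalarGerm_eq_iff]
  have h1 : ∀ᶠ w in 𝓝 0, f (ζ + w) = g (ζ + w) := by
    filter_upwards [(hasExpansion_taylor hf).2, (hasExpansion_taylor hg).2] with w hw1 hw2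
    rw [h] at hw1
    exact hw1.unique hw2
  have ht : Tendsto (fun z => z - ζ) (𝓝 ζ) (𝓝 0) := by
    have : Continuous fun z => z - ζ := by fun_prop
    simpa using this.tendsto ζ
  filter_upwards [ht.eventually h1] with z hz
  simpa using hz

lemma taylor_add (a b : Oat (Fin m → ℂ) ζ) : taylor (a + b) = taylor a + taylor b := by
  obtain ⟨f, hf, rfl⟩ := exists_scalarGerm a
  obtain ⟨g, hg, rfl⟩ := exists_scalarGerm b
  exact taylor_scalarGerm (hf := hf.add hg) ((hasExpansion_taylor hf).add (hasExpansion_taylor hg))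

lemma taylor_constHom_mul (c : ℂ) (a : Oat (Fin m → ℂ) ζ) :
    taylor (constHom ζ c * a) = c • taylor a := by
  obtain ⟨f, hf, rfl⟩ := exists_scalarGerm a
  exact taylor_scalarGerm (hf := analyticAt_const.mul hf)
    ((hasExpansion_taylor hf).clm_comp (c • ContinuousLinearMap.id ℂ ℂ))

lemma norm_taylor_le (a : Oat (Fin m → ℂ) ζ) :
    ∃ C R : ℝ, 0 ≤ C ∧ 0 < R ∧ ∀ α, ‖taylor a α‖ ≤ C * R ^ α.degree := by
  obtain ⟨s, hs, h⟩ := (isConvergent_taylor a).exists_const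
  refine ⟨(weightedNorm (fun _ => s) (taylor a)).toReal, (s : ℝ)⁻¹, ENNReal.toReal_nonneg,
    inv_pos.2 hs, fun α => ?_⟩
  have h1 : ‖taylor a α‖ₑ * weight (fun _ => s) α ≤ weightedNorm (fun _ => s) (taylor a) :=
    ENNReal.le_tsum α
  have h2 := ENNReal.toReal_mono h h1
  rw [weight_const, ENNReal.toReal_mul, toReal_enorm, ENNReal.toReal_pow,
    ENNReal.coe_toReal] at h2
  rw [inv_pow, ← div_eq_mul_inv, le_div_iff₀ (by positivity)]
  exact h2

end Taylor

section AutomaticContinuity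

/-- Every bounded sequence of vectors can be summed against the powers of each element of `I`. -/
def HasChains {R : Type*} [CommRing R] (I : Ideal R) {M : Type*} [AddCommGroup M] [Module R M]
    {F : Type*} [NormedAddCommGroup F] (φ : F → M) : Prop :=
  ∀ a ∈ I, ∀ e : ℕ → F, (∀ j, ‖e j‖ ≤ 1) → ∃ x : ℕ → M, ∀ k, x k = φ (e k) + a • x (k + 1)

variable {m : ℕ} {ζ : Fin (m + 1) → ℂ} {F : Type*} [NormedAddCommGroup F] [NormedSpace ℂ F]

lemma analyticAt_coord : AnalyticAt ℂ (fun z : Fin (m + 1) → ℂ => z 0 - ζ 0) ζ :=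
  ((ContinuousLinearMap.proj (R := ℂ) (φ := fun _ : Fin (m + 1) => ℂ) 0).analyticAt ζ).sub
    analyticAt_const

lemma taylor_coord_mul (a : Oat (Fin (m + 1) → ℂ) ζ) :
    taylor (scalarGerm _ (analyticAt_coord (ζ := ζ)) * a) =
      shiftUp (Finsupp.single 0 1) (taylor a) := by
  obtain ⟨f, hf, rfl⟩ := exists_scalarGerm a
  refine taylor_scalarGerm (hf := analyticAt_coord.mul hf)
    (((hasExpansion_taylor hf).monom_smul (Finsupp.single 0 1)).congr (.of_forall fun w => ?_))
  simp [monom_single]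

lemma shiftUp_single_cons_zero (c : (Fin (m + 1) →₀ ℕ) → ℂ) (β : Fin m →₀ ℕ) :
    shiftUp (Finsupp.single 0 1) c (Finsupp.cons 0 β) = 0 := by
  refine shiftUp_of_notMem_range c ?_
  rintro ⟨γ, hγ⟩
  simpa using DFunLike.congr_fun hγ 0

lemma shiftUp_single_cons_succ (c : (Fin (m + 1) →₀ ℕ) → ℂ) (k : ℕ) (β : Fin m →₀ ℕ) :
    shiftUp (Finsupp.single 0 1) c (Finsupp.cons (k + 1) β) = c (Finsupp.cons k β) := by
  rw [← shiftUp_add (Finsupp.single 0 1) c (Finsupp.cons k β)]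
  congr 1
  ext i
  refine Fin.cases ?_ (fun i => ?_) i <;> simp

lemma taylor_chain {x y : ℕ → Oat (Fin (m + 1) → ℂ) ζ}
    (h : ∀ k, x k = y k + scalarGerm _ (analyticAt_coord (ζ := ζ)) * x (k + 1))
    (β : Fin m →₀ ℕ) (k n : ℕ) : taylor (x n) (Finsupp.cons k β) =
      ∑ p ∈ Finset.HasAntidiagonal.antidiagonal k, taylor (y (n + p.2)) (Finsupp.cons p.1 β) := by
  induction k generalizing n with
  | zero => simp [h n, taylor_add, taylor_coord_mul, shiftUp_single_cons_zero]
  | succ k ih =>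
    rw [h n, taylor_add, taylor_coord_mul, Pi.add_apply, shiftUp_single_cons_succ, ih,
      Finset.Nat.sum_antidiagonal_succ']
    simp only [add_zero, add_assoc, add_comm 1]

/-- The Taylor coefficients of an `O_ζ`-valued linear map, as functionals. -/
noncomputable def taylorFunctional (φ : F →ₛₗ[constHom ζ] Oat (Fin (m + 1) → ℂ) ζ)
    (α : Fin (m + 1) →₀ ℕ) : F →ₗ[ℂ] ℂ where
  toFun e := taylor (φ e) α
  map_add' e e' := by rw [map_add, taylor_add, Pi.add_apply]
  map_smul' c e := by
    rw [map_smulₛₗ, smul_eq_mul, taylor_constHom_mul, Pi.smul_apply, RingHom.id_apply]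

lemma continuous_taylorFunctional {φ : F →ₛₗ[constHom ζ] Oat (Fin (m + 1) → ℂ) ζ}
    (h : HasChains (mIdeal _ ζ) φ) (α : Fin (m + 1) →₀ ℕ) :
    Continuous (taylorFunctional φ α) := by
  obtain ⟨B, hB⟩ := bounded_of_convolution_growth
    (fun i e => taylorFunctional φ (Finsupp.cons i α.tail) e) (fun e he => by
      obtain ⟨x, hx⟩ := h (scalarGerm _ analyticAt_coord)
        (scalarGerm_mem_mIdeal.2 (sub_self _)) e he
      obtain ⟨C, R, hC, hR, hx0⟩ := norm_taylor_le (x 0)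
      refine ⟨C * R ^ α.tail.degree, R, fun k => ?_⟩
      have h1 := taylor_chain hx α.tail k 0
      simp only [zero_add] at h1
      change ‖∑ p ∈ Finset.HasAntidiagonal.antidiagonal k,
        taylor (φ (e p.2)) (Finsupp.cons p.1 α.tail)‖ ≤ _
      rw [← h1]
      refine (hx0 _).trans (le_of_eq ?_)
      have h2 : (Finsupp.cons k α.tail).degree = α.tail.degree + k := by
        simp [Finsupp.degree_eq_sum, Fin.sum_univ_succ, add_comm]
      rw [h2, pow_add, mul_assoc]) (α 0)
  simp only [Finsupp.cons_tail] at hB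
  refine AddMonoidHomClass.continuous_of_bound (taylorFunctional φ α) (B / 1) fun e => ?_
  exact LinearMap.bound_of_ball_bound' one_pos B _ (fun z hz => hB z (by simpa using hz)) e

/-- Pointwise geometric bounds on a family of functionals on a Banach space are uniform. -/
lemma isConvergent_of_pointwise_bound [CompleteSpace F] {T : (Fin m →₀ ℕ) → F →L[ℂ] ℂ}
    (h : ∀ e, ∃ C R : ℝ, 0 ≤ C ∧ 0 < R ∧ ∀ α, ‖T α e‖ ≤ C * R ^ α.degree) : IsConvergent T := by
  let A : ℕ → Set F := fun n => {e | ∀ α, ‖T α e‖ ≤ (n : ℝ) ^ (α.degree + 1)}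
  have hA (n : ℕ) : IsClosed (A n) := by
    simp only [A, Set.ofPred_forall]
    exact isClosed_iInter fun α => isClosed_le (by fun_prop) continuous_const
  have hU : ⋃ n, A n = Set.univ := by
    refine Set.eq_univ_of_forall fun e => ?_
    obtain ⟨C, R, hC, hR, hCR⟩ := h e
    obtain ⟨n, hn⟩ := exists_nat_ge (max C R)
    refine Set.mem_iUnion.2 ⟨n, fun α => (hCR α).trans ?_⟩
    rw [pow_succ']
    gcongr
    · exact (le_max_left _ _).trans hn
    · exact (le_max_right _ _).trans hn
  obtain ⟨n, e₀, he₀⟩ := nonempty_interior_of_iUnion_of_closed hA hU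
  obtain ⟨ε, hε, hball⟩ := Metric.mem_nhds_iff.1 (mem_interior_iff_mem_nhds.1 he₀)
  have hT (α : Fin m →₀ ℕ) : ‖T α‖ ≤ 2 * n / (ε / 2) * (n : ℝ) ^ α.degree := by
    refine ContinuousLinearMap.opNorm_le_bound _ (by positivity) fun e => ?_
    have h1 := LinearMap.bound_of_ball_bound' (half_pos hε) (2 * (n : ℝ) ^ (α.degree + 1))
      (T α : F →ₗ[ℂ] ℂ) (fun z hz => ?_) e
    · refine h1.trans (le_of_eq ?_)
      rw [pow_succ]
      ring
    · have hz1 : ‖T α (e₀ + z)‖ ≤ _ := hball (by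
        rw [mem_closedBall_zero_iff] at hz
        rw [Metric.mem_ball, dist_eq_norm, add_sub_cancel_left]
        linarith) α
      have hz0 : ‖T α e₀‖ ≤ _ := hball (Metric.mem_ball_self hε) α
      calc ‖T α z‖ = ‖T α (e₀ + z) - T α e₀‖ := by simp
        _ ≤ _ := norm_sub_le _ _
        _ ≤ _ := by rw [two_mul]; exact add_le_add hz1 hz0
  obtain ⟨c, hc⟩ : ∃ c : ℝ≥0, (c : ℝ) = 2 * n / (ε / 2) := ⟨⟨_, by positivity⟩, rfl⟩
  let r : ℝ≥0 := (2 * (n + 1))⁻¹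
  refine ⟨fun _ => r, fun _ => by positivity, ?_⟩
  have hle (α : Fin m →₀ ℕ) : ‖T α‖ₑ * weight (fun _ => r) α ≤
      c * weight (fun _ => (2⁻¹ : ℝ≥0)) α := by
    have h1 : ‖T α‖₊ ≤ c * (n : ℝ≥0) ^ α.degree := by
      rw [← NNReal.coe_le_coe]
      push_cast
      rw [hc]
      exact hT α
    have h2 : ‖T α‖₊ * r ^ α.degree ≤ c * 2⁻¹ ^ α.degree := by
      calc _ ≤ c * (n : ℝ≥0) ^ α.degree * r ^ α.degree := by gcongr
        _ = c * (n * r) ^ α.degree := by rw [mul_pow, mul_assoc]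
        _ ≤ _ := by
          gcongr
          simp only [r]
          rw [mul_inv, mul_left_comm]
          refine mul_le_of_le_one_right (by positivity) ?_
          rw [← div_eq_mul_inv]
          exact div_le_one_of_le₀ (by simp) (by positivity)
    rw [weight_const, weight_const, enorm_eq_nnnorm]
    exact_mod_cast h2
  refine ne_top_of_le_ne_top ?_ (ENNReal.tsum_le_tsum hle)
  rw [ENNReal.tsum_mul_left]
  exact ENNReal.mul_ne_top ENNReal.coe_ne_top (tsum_weight_ne_top (by norm_num))

/-- A linear map into `O_ζ` along which bounded sequences can be summed is given by a holomorphic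
family of continuous functionals. -/
theorem exists_family_of_hasChains [CompleteSpace F]
    (φ : F →ₛₗ[constHom ζ] Oat (Fin (m + 1) → ℂ) ζ) (h : HasChains (mIdeal _ ζ) φ) :
    ∃ Ψ : OEat (Fin (m + 1) → ℂ) (F →L[ℂ] ℂ) ζ, ∀ e, ap e Ψ = φ e := by
  let T : (Fin (m + 1) →₀ ℕ) → F →L[ℂ] ℂ := fun α => ⟨taylorFunctional φ α,
    continuous_taylorFunctional h α⟩
  have hT : IsConvergent T := isConvergent_of_pointwise_bound fun e => norm_taylor_le (φ e)
  have hexp := hT.hasExpansion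
  set G := fun z => ∑' α, monom z α • T α
  have hG : AnalyticAt ℂ (fun z => G (z - ζ)) ζ :=
    AnalyticAt.comp (g := G) (by simpa using hexp.analyticAt) (analyticAt_id.sub analyticAt_const)
  refine ⟨germOf _ _ ζ _ hG, fun e => taylor_injective ?_⟩
  rw [ap_germOf]
  refine taylor_scalarGerm ?_
  simp only [add_sub_cancel_left]
  exact hexp.clm_comp (ContinuousLinearMap.apply ℂ ℂ e)

end AutomaticContinuity

section Chains

/-- A finite module over a domain maps to a free module with kernel annihilated by a single
nonzero element. -/
lemma exists_linearMap_pi_ker_torsion {R : Type*} [CommRing R] [IsDomain R] (M : Type*)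
    [AddCommGroup M] [Module R M] [Module.Finite R M] :
    ∃ (q : ℕ) (h : M →ₗ[R] (Fin q → R)) (g : R), g ≠ 0 ∧ ∀ x, h x = 0 → g • x = 0 := by
  obtain ⟨n, v, hv⟩ := Module.Finite.exists_fin (R := R) (M := M)
  obtain ⟨s, hs, hmax⟩ := exists_maximal_linearIndepOn R v
  have h1 (i : Fin n) : ∃ a : R, a ≠ 0 ∧ a • v i ∈ Submodule.span R (v '' s) := by
    by_cases hi : i ∈ s
    · exact ⟨1, one_ne_zero, by
        rw [one_smul]
        exact Submodule.subset_span ⟨i, hi, rfl⟩⟩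
    · exact hmax i hi
  choose a ha0 ha using h1
  let A := ∏ i, a i
  have hA (x : M) : (LinearMap.lsmul R M A) x ∈
      Submodule.span R (Set.range fun i : s => v i) := by
    rw [← Set.image_eq_range]
    have hx : x ∈ Submodule.span R (Set.range v) := hv ▸ Submodule.mem_top
    induction hx using Submodule.span_induction with
    | mem x hx =>
      obtain ⟨i, rfl⟩ := hx
      obtain ⟨b, hb⟩ := Finset.dvd_prod_of_mem a (Finset.mem_univ i)
      rw [LinearMap.lsmul_apply, show A = a i * b from hb, mul_comm, mul_smul]
      exact Submodule.smul_mem _ _ (ha i)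
    | zero => simp
    | add x y _ _ hx hy =>
      rw [map_add]
      exact add_mem hx hy
    | smul c x _ hx =>
      rw [map_smul]
      exact Submodule.smul_mem _ _ hx
  let t := (Finite.equivFin s).symm
  refine ⟨Nat.card s, LinearMap.funLeft R R t ∘ₗ Finsupp.lcoeFun ∘ₗ hs.repr ∘ₗ
    (LinearMap.lsmul R M A).codRestrict _ hA, A, Finset.prod_ne_zero_iff.2 fun i _ => ha0 i,
    fun x hx => ?_⟩
  have h2 : hs.repr ((LinearMap.lsmul R M A).codRestrict _ hA x) = 0 := by
    refine DFunLike.coe_injective ?_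
    refine LinearMap.funLeft_injective_of_surjective R R t t.surjective ?_
    exact hx.trans (map_zero (LinearMap.funLeft R R t)).symm
  exact congrArg Subtype.val (LinearMap.ker_eq_bot'.1 (LinearIndependent.repr_ker hs) _ h2)

variable {R : Type*} [CommRing R] {I : Ideal R} {M : Type*} [AddCommGroup M] [Module R M]
  {N : Type*} [AddCommGroup N] [Module R N] {F : Type*} [NormedAddCommGroup F]

lemma HasChains.map {φ : F → M} (h : HasChains I φ) (u : M →ₗ[R] N) :
    HasChains I fun e => u (φ e) := by
  intro a ha e he
  obtain ⟨x, hx⟩ := h a ha e he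
  exact ⟨fun k => u (x k), fun k => by rw [← map_smul, ← map_add, ← hx]⟩

lemma HasChains.sub {φ ψ : F → M} (hφ : HasChains I φ) (hψ : HasChains I ψ) :
    HasChains I fun e => φ e - ψ e := by
  intro a ha e he
  obtain ⟨x, hx⟩ := hφ a ha e he
  obtain ⟨y, hy⟩ := hψ a ha e he
  refine ⟨fun k => x k - y k, fun k => ?_⟩
  rw [smul_sub, sub_add_sub_comm, ← hx, ← hy]

/-- Chains of a map with values in the kernel of a map to a free module lie in that kernel. -/
lemma HasChains.codRestrict_ker [IsNoetherianRing R] [IsDomain R] (hI : I ≠ ⊤) {φ : F → M}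
    (h : HasChains I φ) {q : ℕ} (u : M →ₗ[R] (Fin q → R)) (hu : ∀ e, φ e ∈ LinearMap.ker u) :
    HasChains I fun e => (⟨φ e, hu e⟩ : LinearMap.ker u) := by
  intro a ha e he
  obtain ⟨x, hx⟩ := h a ha e he
  have h1 (k : ℕ) : u (x k) = a • u (x (k + 1)) := by
    conv_lhs => rw [hx k, map_add, map_smul, LinearMap.mem_ker.1 (hu _), zero_add]
  have h2 (n k : ℕ) : u (x k) = a ^ n • u (x (k + n)) := by
    induction n with
    | zero => simp
    | succ n ih => rw [ih, h1, smul_smul, ← pow_succ, add_assoc]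
  have h3 (k : ℕ) : x k ∈ LinearMap.ker u := by
    rw [LinearMap.mem_ker]
    ext i
    rw [Pi.zero_apply, ← Ideal.mem_bot, ← Ideal.iInf_pow_eq_bot_of_isDomain I hI,
      Submodule.mem_iInf]
    intro n
    rw [h2 n, Pi.smul_apply, smul_eq_mul]
    exact Ideal.mul_mem_right _ _ (Ideal.pow_mem_pow ha n)
  exact ⟨fun k => ⟨x k, h3 k⟩, fun k => Subtype.ext (hx k)⟩

end Chains

section ConstChains

attribute [local instance] germModule germSMul

variable {Y : Type*} [NormedAddCommGroup Y] [NormedSpace ℂ Y] {η : Y}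
  {F : Type*} [NormedAddCommGroup F] [NormedSpace ℂ F] [CompleteSpace F]

lemma summable_pow_smul {e : ℕ → F} (he : ∀ j, ‖e j‖ ≤ 1) {t : ℂ} (ht : ‖t‖ < 1) :
    Summable fun j => t ^ j • e j := by
  refine Summable.of_norm_bounded (g := fun j => ‖t‖ ^ j)
    (summable_geometric_of_lt_one (norm_nonneg _) ht) fun j => ?_
  rw [norm_smul, norm_pow]
  exact mul_le_of_le_one_right (by positivity) (he j)

lemma analyticAt_tsum_pow_smul {e : ℕ → F} (he : ∀ j, ‖e j‖ ≤ 1) :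
    AnalyticAt ℂ (fun t : ℂ => ∑' j, t ^ j • e j) 0 := by
  have h := Complex.differentiableOn_tsum_of_summable_norm (F := fun j (t : ℂ) => t ^ j • e j)
    (U := Metric.ball 0 2⁻¹) (summable_geometric_of_lt_one (r := 2⁻¹) (by norm_num) (by norm_num))
    (fun j => by fun_prop) Metric.isOpen_ball (fun j w hw => by
      rw [mem_ball_zero_iff] at hw
      rw [norm_smul, norm_pow]
      calc ‖w‖ ^ j * ‖e j‖ ≤ ‖w‖ ^ j * 1 := by gcongr; exact he j
        _ ≤ _ := by rw [mul_one]; gcongr)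
  exact h.analyticAt (Metric.ball_mem_nhds 0 (by norm_num))

lemma hasChains_constGerm : HasChains (mIdeal Y η) (constGerm Y F η) := by
  intro a ha e he
  obtain ⟨f, hf, rfl⟩ := exists_scalarGerm a
  rw [scalarGerm_mem_mIdeal] at ha
  have hG (k : ℕ) : AnalyticAt ℂ (fun z => ∑' j, f z ^ j • e (k + j)) η :=
    AnalyticAt.comp (g := fun t : ℂ => ∑' j, t ^ j • e (k + j))
      (by rw [ha]; exact analyticAt_tsum_pow_smul fun j => he _) hf
  refine ⟨fun k => germOf Y F η _ (hG k), fun k => ?_⟩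
  rw [scalarGerm_smul_germOf, constGerm, germOf_add, germOf_eq_iff]
  have h1 : ∀ᶠ z in 𝓝 η, ‖f z‖ < 1 :=
    hf.continuousAt.norm.eventually_lt_const (by simp [ha])
  filter_upwards [h1] with z hz
  rw [(summable_pow_smul (e := fun j => e (k + j)) (fun j => he _) hz).tsum_eq_zero_add,
    ← (summable_pow_smul (e := fun j => e (k + 1 + j)) (fun j => he _) hz).tsum_const_smul]
  simp only [pow_zero, one_smul, add_zero, smul_smul, ← pow_succ', add_assoc, add_comm 1]

end ConstChains

section Representation

universe v w

attribute [local instance] germModule germSMul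

/-- No nonzero element of `M` is annihilated by `I`. -/
def SocleFree {R : Type*} [CommRing R] (I : Ideal R) (M : Type*) [AddCommGroup M] [Module R M] :
    Prop :=
  ∀ y : M, (∀ a ∈ I, a • y = 0) → y = 0

/-- `φ` is a finite sum of elements of `M` with holomorphic families of functionals as
coefficients. -/
def IsRepresentable {Y : Type*} [NormedAddCommGroup Y] [NormedSpace ℂ Y] (η : Y) {M : Type*}
    [AddCommGroup M] [Module (Oat Y η) M] {F : Type*} [NormedAddCommGroup F] [NormedSpace ℂ F]
    (φ : F → M) : Prop :=
  ∃ (ι : Type) (_ : Fintype ι) (x : ι → M) (Ψ : ι → OEat Y (F →L[ℂ] ℂ) η),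
    ∀ e, φ e = ∑ i, ap e (Ψ i) • x i

section General

variable {Y : Type*} [NormedAddCommGroup Y] [NormedSpace ℂ Y] {η : Y} {M : Type*}
    [AddCommGroup M] [Module (Oat Y η) M] {F : Type*} [NormedAddCommGroup F] [NormedSpace ℂ F]

lemma IsRepresentable.exists_of_span {φ : F → M} (h : IsRepresentable η φ) {n : ℕ} {y : Fin n → M}
    (hy : ∀ x, ∃ c : Fin n → Oat Y η, x = ∑ k, c k • y k) :
    ∃ Ψ : Fin n → OEat Y (F →L[ℂ] ℂ) η, ∀ e, φ e = ∑ k, ap e (Ψ k) • y k := by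
  obtain ⟨ι, _, x, Ψ, hΨ⟩ := h
  choose c hc using hy
  refine ⟨fun k => ∑ i, c (x i) k • Ψ i, fun e => ?_⟩
  rw [hΨ e]
  simp_rw [map_sum, map_smul, Finset.sum_smul]
  rw [Finset.sum_comm]
  refine Finset.sum_congr rfl fun i _ => ?_
  conv_lhs => rw [hc (x i), Finset.smul_sum]
  refine Finset.sum_congr rfl fun k _ => ?_
  rw [smul_smul, smul_eq_mul, mul_comm]

lemma IsRepresentable.add {φ ψ : F → M} (hφ : IsRepresentable η φ) (hψ : IsRepresentable η ψ) :
    IsRepresentable η fun e => φ e + ψ e := by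
  obtain ⟨ι, _, x, Ψ, hΨ⟩ := hφ
  obtain ⟨κ, _, y, Φ, hΦ⟩ := hψ
  refine ⟨ι ⊕ κ, inferInstance, Sum.elim x y, Sum.elim Ψ Φ, fun e => ?_⟩
  simp [hΨ, hΦ, Fintype.sum_sum_type]

lemma IsRepresentable.map {N : Type*} [AddCommGroup N] [Module (Oat Y η) N] {φ : F → M}
    (hφ : IsRepresentable η φ) (u : M →ₗ[Oat Y η] N) : IsRepresentable η fun e => u (φ e) := by
  obtain ⟨ι, _, x, Ψ, hΨ⟩ := hφ
  exact ⟨ι, inferInstance, fun i => u (x i), Ψ, fun e => by simp [hΨ e]⟩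

end General

/-- Every linear map into a socle-free finite module along which bounded sequences can be summed
is representable. -/
def RepresentsChains {m : ℕ} (ζ : Fin m → ℂ) : Prop :=
  ∀ (M : Type w) [AddCommGroup M] [Module (Oat (Fin m → ℂ) ζ) M]
    [Module.Finite (Oat (Fin m → ℂ) ζ) M], SocleFree (mIdeal _ ζ) M →
    ∀ (F : Type v) [NormedAddCommGroup F] [NormedSpace ℂ F] [CompleteSpace F]
      (φ : F →ₛₗ[constHom ζ] M), HasChains (mIdeal _ ζ) φ → IsRepresentable ζ φ

section Torsion

variable {m : ℕ} {ζ : Fin (m + 1) → ℂ} {M : Type w} [AddCommGroup M]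
  [Module (Oat (Fin (m + 1) → ℂ) ζ) M] [Module (Oat (Fin m → ℂ) 0) M]
  {L : (Fin (m + 1) → ℂ) ≃L[ℂ] (Fin (m + 1) → ℂ)} {d : ℕ} {g : Oat (Fin (m + 1) → ℂ) ζ}

lemma finite_of_division [Module.Finite (Oat (Fin (m + 1) → ℂ) ζ) M]
    (hcomp : ∀ (b : Oat (Fin m → ℂ) 0) (y : M), b • y = tailScalar ζ L b • y)
    (hg : ∀ y : M, g • y = 0)
    (hdiv : ∀ f : Oat (Fin (m + 1) → ℂ) ζ, ∃ (Q : Oat (Fin (m + 1) → ℂ) ζ)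
        (P : Fin d → Oat (Fin m → ℂ) 0),
        f = g * Q + ∑ i : Fin d, headGerm ζ L ^ (i : ℕ) * tailScalar ζ L (P i)) :
    Module.Finite (Oat (Fin m → ℂ) 0) M := by
  obtain ⟨n, x, hx⟩ := Module.Finite.exists_fin (R := Oat (Fin (m + 1) → ℂ) ζ) (M := M)
  let y : Fin n × Fin d → M := fun k => headGerm ζ L ^ (k.2 : ℕ) • x k.1
  refine ⟨Submodule.fg_def.2 ⟨Set.range y, Set.finite_range y, ?_⟩⟩
  rw [Submodule.eq_top_iff']
  intro z
  have hz : z ∈ Submodule.span (Oat (Fin (m + 1) → ℂ) ζ) (Set.range x) := hx ▸ Submodule.mem_top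
  obtain ⟨c, rfl⟩ := (Submodule.mem_span_range_iff_exists_fun _).1 hz
  refine sum_mem fun k _ => ?_
  obtain ⟨Q, P, hQP⟩ := hdiv (c k)
  rw [hQP, add_smul, mul_smul, hg, zero_add, Finset.sum_smul]
  refine sum_mem fun i _ => ?_
  rw [mul_comm, mul_smul, ← hcomp]
  exact Submodule.smul_mem _ _ (Submodule.subset_span ⟨(k, i), rfl⟩)

open Polynomial in
lemma socleFree_of_division
    (hcomp : ∀ (b : Oat (Fin m → ℂ) 0) (y : M), b • y = tailScalar ζ L b • y)
    (hg : ∀ y : M, g • y = 0) (hs : SocleFree (mIdeal _ ζ) M)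
    (hdiv : ∀ f : Oat (Fin (m + 1) → ℂ) ζ, ∃ (Q : Oat (Fin (m + 1) → ℂ) ζ)
        (P : Fin d → Oat (Fin m → ℂ) 0),
        f = g * Q + ∑ i : Fin d, headGerm ζ L ^ (i : ℕ) * tailScalar ζ L (P i)) :
    SocleFree (mIdeal (Fin m → ℂ) 0) M := by
  have hinj (y : M) (hy : ∀ b ∈ mIdeal (Fin m → ℂ) 0, b • y = 0) (h : headGerm ζ L • y = 0) :
      y = 0 := by
    refine hs y fun a ha => ?_
    let J : Ideal (Oat (Fin (m + 1) → ℂ) ζ) :=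
      LinearMap.ker (LinearMap.toSpanSingleton (Oat (Fin (m + 1) → ℂ) ζ) M y)
    have hJ : Ideal.span {headGerm ζ L} ⊔ (mIdeal (Fin m → ℂ) 0).map (tailScalar ζ L) ≤ J := by
      refine sup_le (Ideal.span_le.2 (Set.singleton_subset_iff.2 h))
        (Ideal.map_le_iff_le_comap.2 ?_)
      intro b hb
      exact (hcomp b y).symm.trans (hy b hb)
    exact hJ (mIdeal_le_headGerm_sup L ha)
  have hpow (n : ℕ) (y : M) (hy : ∀ b ∈ mIdeal (Fin m → ℂ) 0, b • y = 0)
      (h : headGerm ζ L ^ n • y = 0) : y = 0 := by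
    induction n with
    | zero => simpa using h
    | succ n ih =>
      refine ih (hinj _ (fun b hb => ?_) ?_)
      · rw [hcomp, smul_comm, ← hcomp, hy b hb, smul_zero]
      · rwa [smul_smul, ← pow_succ']
  intro y hy
  obtain ⟨Q, P, hQP⟩ := hdiv (headGerm ζ L ^ d)
  let p : ℂ[X] := X ^ d - ∑ i : Fin d, C (evalAt _ 0 (P i)) * X ^ (i : ℕ)
  have hp : p ≠ 0 := by
    refine (monic_X_pow_sub ?_).ne_zero
    rw [degree_lt_iff_coeff_zero]
    intro k hk
    rw [finsetSum_coeff]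
    refine Finset.sum_eq_zero fun i _ => ?_
    rw [coeff_C_mul_X_pow, if_neg (by omega)]
  have hpy : p.eval₂ (constHom ζ) (headGerm ζ L) • y = 0 := by
    have h1 (i : Fin d) : tailScalar ζ L (P i) • y = constHom ζ (evalAt _ 0 (P i)) • y := by
      have h2 := hy _ (sub_constHom_evalAt_mem (P i))
      rw [hcomp, map_sub, sub_smul, sub_eq_zero] at h2
      exact h2
    rw [eval₂_sub, eval₂_X_pow, sub_smul, sub_eq_zero, hQP, add_smul, mul_smul, hg, zero_add,
      eval₂_finsetSum, Finset.sum_smul, Finset.sum_smul]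
    refine Finset.sum_congr rfl fun i _ => ?_
    rw [mul_smul, h1, eval₂_mul, eval₂_C, eval₂_X_pow, mul_comm, mul_smul]
  obtain ⟨q, hpq, hq⟩ := exists_eq_pow_rootMultiplicity_mul_and_not_dvd p hp 0
  rw [dvd_iff_isRoot, IsRoot.def] at hq
  rw [hpq, C_0, sub_zero, eval₂_mul, eval₂_X_pow, mul_smul] at hpy
  have hu : IsUnit (q.eval₂ (constHom ζ) (headGerm ζ L)) := by
    refine isUnit_of_notMem_mIdeal fun h => hq ?_
    have h3 : evalAt _ ζ (headGerm ζ L) = 0 := headGerm_mem_mIdeal L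
    have h4 : evalAt _ ζ (q.eval₂ (constHom ζ) (headGerm ζ L)) = 0 := h
    rw [hom_eval₂, h3] at h4
    exact h4
  refine (hu.smul_eq_zero).1 (hpow _ _ (fun b hb => ?_) hpy)
  rw [hcomp, smul_comm, ← hcomp, hy b hb, smul_zero]

end Torsion

lemma isRepresentable_of_torsion {m : ℕ} (ih : RepresentsChains.{v, w} (0 : Fin m → ℂ))
    {ζ : Fin (m + 1) → ℂ} {M : Type w} [AddCommGroup M] [Module (Oat (Fin (m + 1) → ℂ) ζ) M]
    [Module.Finite (Oat (Fin (m + 1) → ℂ) ζ) M] (hs : SocleFree (mIdeal _ ζ) M)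
    {g : Oat (Fin (m + 1) → ℂ) ζ} (hg0 : g ≠ 0) (hg : ∀ y : M, g • y = 0)
    {F : Type v} [NormedAddCommGroup F] [NormedSpace ℂ F] [CompleteSpace F]
    (φ : F →ₛₗ[constHom ζ] M) (hφ : HasChains (mIdeal _ ζ) φ) : IsRepresentable ζ φ := by
  obtain ⟨L, d, hdiv, -⟩ := exists_weierstrass_division.{0} hg0
  let _ : Module (Oat (Fin m → ℂ) 0) M := Module.compHom M (tailScalar ζ L)
  have hcomp (b : Oat (Fin m → ℂ) 0) (y : M) : b • y = tailScalar ζ L b • y := rfl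
  have := finite_of_division hcomp hg hdiv
  let φ' : F →ₛₗ[constHom (0 : Fin m → ℂ)] M :=
    { toFun := φ
      map_add' := map_add φ
      map_smul' := fun c e => map_smulₛₗ φ c e }
  obtain ⟨ι, _, x, Ψ, hΨ⟩ := ih M (socleFree_of_division hcomp hg hs hdiv) F φ'
    fun b hb e he => hφ (tailScalar ζ L b) (pullScalar_mem_mIdeal _ _ hb) e he
  refine ⟨ι, inferInstance, x, fun i => tailGerm ζ L (Ψ i), fun e => (hΨ e).trans ?_⟩
  refine Finset.sum_congr rfl fun i _ => ?_
  rw [hcomp, ap_pullGerm]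

end Representation

section Main

universe v w

attribute [local instance] germModule germSMul

/-- The homomorphism into `M` with families of functionals as coefficients. -/
noncomputable def pairSum {Y : Type*} [NormedAddCommGroup Y] [NormedSpace ℂ Y] {η : Y} {M : Type*}
    [AddCommGroup M] [Module (Oat Y η) M] {F : Type*} [NormedAddCommGroup F] [NormedSpace ℂ F]
    {ι : Type*} [Fintype ι] (Ψ : ι → OEat Y (F →L[ℂ] ℂ) η) (x : ι → M) :
    OEat Y F η →ₗ[Oat Y η] M :=
  ∑ i, (LinearMap.toSpanSingleton (Oat Y η) M (x i)) ∘ₗ pair (Ψ i)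

lemma pairSum_constGerm {Y : Type*} [NormedAddCommGroup Y] [NormedSpace ℂ Y] {η : Y} {M : Type*}
    [AddCommGroup M] [Module (Oat Y η) M] {F : Type*} [NormedAddCommGroup F] [NormedSpace ℂ F]
    {ι : Type*} [Fintype ι] (Ψ : ι → OEat Y (F →L[ℂ] ℂ) η) (x : ι → M) (e : F) :
    pairSum Ψ x (constGerm Y F η e) = ∑ i, ap e (Ψ i) • x i := by
  simp [pairSum, ap_apply]

/-- The constant germs, as a semilinear map. -/
noncomputable def constGermHom {Y : Type*} [NormedAddCommGroup Y] [NormedSpace ℂ Y] (η : Y)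
    (F : Type*) [NormedAddCommGroup F] [NormedSpace ℂ F] : F →ₛₗ[constHom η] OEat Y F η where
  toFun := constGerm Y F η
  map_add' := constGerm_add
  map_smul' := constGerm_smul

theorem representsChains {m : ℕ} (ζ : Fin m → ℂ) : RepresentsChains.{v, w} ζ := by
  induction m with
  | zero =>
    intro M _ _ _ hs F _ _ _ φ _
    refine ⟨Empty, inferInstance, nofun, nofun, fun e => ?_⟩
    rw [Finset.univ_eq_empty, Finset.sum_empty]
    refine hs _ fun a ha => ?_
    obtain ⟨f, hf, rfl⟩ := exists_scalarGerm a
    rw [scalarGerm_mem_mIdeal] at ha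
    have h0 : scalarGerm f hf = 0 := by
      refine scalarGerm_eq_zero_iff.2 (.of_forall fun z => ?_)
      rw [Subsingleton.elim z ζ, ha]
    rw [h0, zero_smul]
  | succ m ih =>
    intro M _ _ _ hs F _ _ _ φ hφ
    obtain ⟨q, h, g, hg0, hg⟩ := exists_linearMap_pi_ker_torsion (R := Oat (Fin (m + 1) → ℂ) ζ) M
    have h1 (i : Fin q) : ∃ Φ : OEat (Fin (m + 1) → ℂ) (F →L[ℂ] ℂ) ζ, ∀ e, ap e Φ = h (φ e) i :=
      exists_family_of_hasChains ((LinearMap.proj i ∘ₗ h).comp φ)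
        (hφ.map (LinearMap.proj i ∘ₗ h))
    choose Φ hΦ using h1
    obtain ⟨κ, _, b, hb, hgen⟩ := generatesFamilies.{v} ζ (LinearMap.range h)
    choose y hy using hb
    obtain ⟨c, hc⟩ := hgen F Φ fun e => ⟨φ e, funext fun i => (hΦ i e).symm⟩
    let φ₁ : F →ₛₗ[constHom ζ] M := (pairSum c y).comp (constGermHom ζ F)
    have hφ₁ : HasChains (mIdeal _ ζ) φ₁ := hasChains_constGerm.map (pairSum c y)
    have hφ₁' (e : F) : φ₁ e = ∑ j, ap e (c j) • y j := pairSum_constGerm c y e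
    have hker (e : F) : φ e - φ₁ e ∈ LinearMap.ker h := by
      rw [LinearMap.mem_ker, map_sub, sub_eq_zero, hφ₁', map_sum]
      ext i : 1
      rw [← hΦ i e, hc i, map_sum, Finset.sum_apply]
      refine Finset.sum_congr rfl fun j _ => ?_
      rw [map_smul, map_smul, hy, Pi.smul_apply, smul_eq_mul, smul_eq_mul, mul_comm]
    let φ₂ : F →ₛₗ[constHom ζ] LinearMap.ker h := (φ - φ₁).codRestrict (LinearMap.ker h) hker
    have hφ₂ : HasChains (mIdeal _ ζ) φ₂ := (hφ.sub hφ₁).codRestrict_ker mIdeal_ne_top h hker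
    have h2 : IsRepresentable ζ φ₂ := isRepresentable_of_torsion (ih 0)
      (fun y hy => Subtype.ext (hs y fun a ha => congrArg Subtype.val (hy a ha))) hg0
      (fun y => Subtype.ext (hg y y.2)) φ₂ hφ₂
    have h3 : IsRepresentable ζ φ₁ := ⟨κ, inferInstance, y, c, hφ₁'⟩
    have h4 := (h2.map (LinearMap.ker h).subtype).add h3
    convert h4 using 2 with e
    exact (sub_add_cancel _ _).symm

/-- A homomorphism on vector-valued germs with values in a finite module vanishes as soon as it
vanishes on constant germs. -/
lemma eq_zero_of_forall_constGerm {m : ℕ} {ζ : Fin m → ℂ} {M : Type*} [AddCommGroup M]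
    [Module (Oat (Fin m → ℂ) ζ) M] [Module.Finite (Oat (Fin m → ℂ) ζ) M] {F : Type*}
    [NormedAddCommGroup F] [NormedSpace ℂ F] [CompleteSpace F]
    {u : OEat (Fin m → ℂ) F ζ →ₗ[Oat (Fin m → ℂ) ζ] M}
    (hu : ∀ e, u (constGerm _ F ζ e) = 0) : u = 0 := by
  rw [← LinearMap.range_eq_bot]
  refine Submodule.eq_bot_of_le_smul_of_le_jacobson_bot (mIdeal _ ζ) _ (IsNoetherian.noetherian _)
    ?_ mIdeal_le_jacobson
  rintro - ⟨f, rfl⟩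
  obtain ⟨e, y, rfl, hy⟩ := exists_constGerm_add_mem f
  rw [map_add, hu, zero_add, LinearMap.range_eq_map, ← Submodule.map_smul'']
  exact Submodule.mem_map_of_mem hy

end Main

/-- **Theorem 1.3.** Let `ζ ∈ ℂ^m`, `1 ≤ m`, `M` a finite `O_ζ`-module of
positive `m_ζ`-depth, and `p : O_ζ^n → M` an epimorphism. Then every `O_ζ`-homomorphism
`φ : O^E_ζ → M` factors through `p`. -/
theorem hom_to_finite_module_factors
    (m n : ℕ) (hm : 1 ≤ m) (ζ : Fin m → ℂ) [CompleteSpace E]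
    (M : Type*) [AddCommGroup M] [Module (Oat (Fin m → ℂ) ζ) M]
    [Module.Finite (Oat (Fin m → ℂ) ζ) M]
    (hdepth : IsDepthPos (Oat (Fin m → ℂ) ζ) (mIdeal (Fin m → ℂ) ζ) M)
    (p : (Fin n → Oat (Fin m → ℂ) ζ) →ₗ[Oat (Fin m → ℂ) ζ] M)
    (hp : Function.Surjective p)
    (φ : OEat (Fin m → ℂ) E ζ →ₗ[Oat (Fin m → ℂ) ζ] M) :
    ∃ ψ : OEat (Fin m → ℂ) E ζ →ₗ[Oat (Fin m → ℂ) ζ] (Fin n → Oat (Fin m → ℂ) ζ),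
      φ = p ∘ₗ ψ := by
  rcases hdepth with h | ⟨r, hr, hr0, -⟩
  · have hM : (⊤ : Submodule (Oat (Fin m → ℂ) ζ) M) = ⊥ :=
      Submodule.eq_bot_of_le_smul_of_le_jacobson_bot (mIdeal _ ζ) ⊤ Module.Finite.fg_top h.ge
        mIdeal_le_jacobson
    refine ⟨0, LinearMap.ext fun f => ?_⟩
    have h1 : φ f ∈ (⊤ : Submodule (Oat (Fin m → ℂ) ζ) M) := Submodule.mem_top
    rw [hM, Submodule.mem_bot] at h1
    rw [h1, LinearMap.comp_zero, LinearMap.zero_apply]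
  · let φ₀ : E →ₛₗ[constHom ζ] M := φ.comp (constGermHom ζ E)
    have hφ₀ : HasChains (mIdeal _ ζ) φ₀ := hasChains_constGerm.map φ
    have hrep := representsChains ζ M (fun y hy => hr0 y (hy r hr)) E φ₀ hφ₀
    obtain ⟨Ψ, hΨ⟩ := hrep.exists_of_span (y := fun k => p (Pi.single k 1)) fun x => by
      obtain ⟨c, rfl⟩ := hp x
      exact ⟨c, by
        conv_lhs => rw [pi_eq_sum_univ' c, map_sum]
        exact Finset.sum_congr rfl fun k _ => by rw [map_smul]⟩
    refine ⟨LinearMap.pi fun k => pair (Ψ k), ?_⟩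
    rw [← sub_eq_zero]
    refine eq_zero_of_forall_constGerm fun e => ?_
    rw [LinearMap.sub_apply, sub_eq_zero, LinearMap.comp_apply]
    refine (hΨ e).trans ?_
    rw [pi_eq_sum_univ' (LinearMap.pi (fun k => pair (Ψ k)) (constGerm (Fin m → ℂ) E ζ e)), map_sum]
    exact Finset.sum_congr rfl fun k _ => by rw [map_smul]; rfl
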